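/- arXiv:2110.03033 — 2 statements merged into one kernel-verified Lean document; each statement's English description precedes it below -/
import Mathlib

section
/- Let P ⊆ ℝ² be a compact convex set with nonempty interior. Then for every target set A ⊆ ℝ² the no-β McMullen game G_P(A) is equivalent to the perfect set game: player I has a winning strategy in G_P(A) if and only if A contains a perfect set, and player II has a winning strategy in G_P(A) if and only if A is countable. -/
open Pointwise Filter Topology Set

/-- The set played by the move `c = (x, ρ)`: the translated scaled copy `x + ρ • P` of `P`. -/
def copySet {X : Type*} [AddCommGroup X] [Module ℝ X] (P : Set X) (c : X × ℝ) : Set X :=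
  c.1 +ᵥ c.2 • P

/-- The rule that the `n`-th move of the run `m` must obey in the no-β McMullen game:
every scaling factor is positive; player II's scaling factor is strictly smaller than that of
player I's preceding move; and each of player I's moves after the first is contained in his
previous move with player II's intervening move removed. -/
def Rule {X : Type*} [AddCommGroup X] [Module ℝ X] (P : Set X) (m : ℕ → X × ℝ) (n : ℕ) : Prop :=
  0 < (m n).2 ∧
    (if n % 2 = 1 then (m n).2 < (m (n - 1)).2
     else n ≠ 0 → copySet P (m n) ⊆ copySet P (m (n - 2)) \ copySet P (m (n - 1)))

/-- A strategy: a function assigning a next move to each finite position. -/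
abbrev Strategy (X : Type*) := List (X × ℝ) → X × ℝ

/-- The run `m` is one in which player I follows the strategy `σ` (player I moves at the
even rounds). -/
def FollowsI {X : Type*} (σ : Strategy X) (m : ℕ → X × ℝ) : Prop :=
  ∀ n, m (2 * n) = σ (List.ofFn fun i : Fin (2 * n) => m i)

/-- The run `m` is one in which player II follows the strategy `σ` (player II moves at the
odd rounds). -/
def FollowsII {X : Type*} (σ : Strategy X) (m : ℕ → X × ℝ) : Prop :=
  ∀ n, m (2 * n + 1) = σ (List.ofFn fun i : Fin (2 * n + 1) => m i)

/-- `σ` is a winning strategy for player I in the no-β McMullen game `G_P(A)`: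
in every run in which player I follows `σ`, player I is never the first to violate the rules,
and if the run obeys all the rules then `(⋂ n, P_{2n}) ∩ A ≠ ∅`. -/
def WinningI {X : Type*} [AddCommGroup X] [Module ℝ X] (P A : Set X) (σ : Strategy X) : Prop :=
  ∀ m : ℕ → X × ℝ, FollowsI σ m →
    (∀ n, (∀ k < 2 * n, Rule P m k) → Rule P m (2 * n)) ∧
    ((∀ n, Rule P m n) → ((⋂ n, copySet P (m (2 * n))) ∩ A).Nonempty)

/-- `σ` is a winning strategy for player II in the no-β McMullen game `G_P(A)`:
in every run in which player II follows `σ`, player II is never the first to violate the rules,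
and if the run obeys all the rules then `(⋂ n, P_{2n}) ∩ A = ∅`. -/
def WinningII {X : Type*} [AddCommGroup X] [Module ℝ X] (P A : Set X) (σ : Strategy X) : Prop :=
  ∀ m : ℕ → X × ℝ, FollowsII σ m →
    (∀ n, (∀ k < 2 * n + 1, Rule P m k) → Rule P m (2 * n + 1)) ∧
    ((∀ n, Rule P m n) → (⋂ n, copySet P (m (2 * n))) ∩ A = ∅)

/-- `A` contains a perfect set (a nonempty closed set with no isolated points). -/
def ContainsPerfectSet {X : Type*} [TopologicalSpace X] (A : Set X) : Prop :=
  ∃ F : Set X, F ⊆ A ∧ Perfect F ∧ F.Nonempty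


abbrev E2 := EuclideanSpace ℝ (Fin 2)

theorem mem_cp {P : Set E2} {c : E2 × ℝ} {x : E2} :
    x ∈ copySet P c ↔ ∃ p ∈ P, x = c.1 + c.2 • p := by
  unfold copySet
  constructor
  · rintro ⟨_, ⟨p, hp, rfl⟩, rfl⟩
    exact ⟨p, hp, rfl⟩
  · rintro ⟨p, hp, rfl⟩
    exact ⟨_, ⟨p, hp, rfl⟩, rfl⟩

theorem mem_cp' {P : Set E2} {c : E2 × ℝ} (hc : 0 < c.2) {x : E2} :
    x ∈ copySet P c ↔ c.2⁻¹ • (x - c.1) ∈ P := by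
  rw [mem_cp]
  constructor
  · rintro ⟨p, hp, rfl⟩
    simpa [smul_smul, hc.ne'] using hp
  · intro h
    exact ⟨_, h, by simp [smul_smul, hc.ne']⟩

theorem interior_copy {P : Set E2} {c : E2 × ℝ} (hc : 0 < c.2) :
    interior (copySet P c) = copySet (interior P) c := by
  unfold copySet
  rw [interior_vadd, interior_smul₀ hc.ne']

theorem isCompact_copy {P : Set E2} (hP : IsCompact P) (c : E2 × ℝ) : IsCompact (copySet P c) := by
  unfold copySet
  exact (hP.smul c.2).vadd c.1

theorem isClosed_copy {P : Set E2} (hP : IsCompact P) (c : E2 × ℝ) : IsClosed (copySet P c) :=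
  (isCompact_copy hP c).isClosed

/-- minimal copies -/
theorem min_copy {P : Set E2} (hP : IsCompact P) (hPi : (interior P).Nonempty) :
    ∃ C : ℝ, 0 < C ∧ ∀ (x : E2) (r : ℝ), 0 < r → ∀ K : Set E2, K ⊆ Metric.closedBall x r →
      K.Nontrivial → ∃ c : E2 × ℝ, 0 < c.2 ∧ c.2 ≤ C * r ∧ K ⊆ copySet P c ∧
        (∀ c' : E2 × ℝ, 0 < c'.2 → c'.2 < c.2 → ¬ K ⊆ copySet P c') ∧
        copySet P c ⊆ Metric.closedBall x (C * r) := by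
  obtain ⟨z0, hz0⟩ := hPi
  obtain ⟨δ, hδ, hball⟩ := Metric.nhds_basis_closedBall.mem_iff.1 (mem_interior_iff_mem_nhds.1 hz0)
  obtain ⟨B, hB⟩ := hP.isBounded.exists_norm_le
  have hB0 : 0 ≤ B := (norm_nonneg z0).trans (hB z0 (interior_subset hz0))
  refine ⟨2 * B / δ + 1 / δ + 1, by positivity, ?_⟩
  intro x r hr K hK hKn
  set R := r / δ with hR
  have hR0 : 0 < R := by positivity
  have hc0 : K ⊆ copySet P (x - R • z0, R) := by
    intro y hy
    rw [mem_cp' hR0]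
    apply hball
    have := hK hy
    rw [Metric.mem_closedBall, dist_eq_norm] at this ⊢
    have e : R⁻¹ • (y - (x - R • z0)) - z0 = R⁻¹ • (y - x) := by
      rw [show y - (x - R • z0) = (y - x) + R • z0 by abel, smul_add, smul_smul,
        inv_mul_cancel₀ hR0.ne', one_smul]; abel
    change ‖R⁻¹ • (y - (x - R • z0)) - z0‖ ≤ δ
    rw [e, norm_smul, norm_inv, Real.norm_of_nonneg hR0.le, inv_mul_le_iff₀ hR0]
    calc ‖y - x‖ ≤ r := this
      _ = R * δ := by rw [hR]; field_simp
  let S : Set (E2 × ℝ) := ⋂ k ∈ K, (fun q : ℝ × E2 => (k - q.1 • q.2, q.1)) '' (Icc 0 R ×ˢ P)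
  have hSm : ∀ c : E2 × ℝ, c ∈ S ↔ ∀ k ∈ K, c.2 ∈ Icc 0 R ∧ k ∈ copySet P c := by
    intro c
    simp only [S, mem_iInter]
    refine forall₂_congr fun k hk => ?_
    rw [mem_cp]
    constructor
    · rintro ⟨⟨ρ, p⟩, ⟨h1, h2⟩, rfl⟩
      exact ⟨h1, p, h2, by simp⟩
    · rintro ⟨h1, p, hp, rfl⟩
      exact ⟨(c.2, p), ⟨h1, hp⟩, by simp⟩
  obtain ⟨k0, hk0⟩ := hKn.nonempty
  have hcomp : ∀ k : E2, IsCompact ((fun q : ℝ × E2 => (k - q.1 • q.2, q.1)) '' (Icc 0 R ×ˢ P)) := by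
    intro k
    exact (isCompact_Icc.prod hP).image (by fun_prop)
  have hSc : IsCompact S := by
    refine (hcomp k0).of_isClosed_subset (isClosed_biInter fun k _ => (hcomp k).isClosed) ?_
    exact biInter_subset_of_mem hk0
  have hSn : S.Nonempty := ⟨(x - R • z0, R), (hSm _).2 fun k hk => ⟨⟨hR0.le, le_rfl⟩, hc0 hk⟩⟩
  obtain ⟨c, hcS, hmin⟩ := hSc.exists_isMinOn hSn continuous_snd.continuousOn
  have hcS' := (hSm c).1 hcS
  have hpos : 0 < c.2 := by
    rcases (hcS' k0 hk0).1.1.lt_or_eq with h | h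
    · exact h
    · exfalso
      obtain ⟨a, ha, b, hb, hab⟩ := hKn
      obtain ⟨p, -, h1⟩ := mem_cp.1 (hcS' a ha).2
      obtain ⟨q, -, h2⟩ := mem_cp.1 (hcS' b hb).2
      apply hab
      rw [h1, h2, ← h]; simp
  have hcR := (hcS' k0 hk0).1.2
  refine ⟨c, hpos, ?_, fun k hk => (hcS' k hk).2, ?_, ?_⟩
  · refine hcR.trans ?_
    have : 0 ≤ 2 * B / δ * r := by positivity
    have e : R = 1 / δ * r := by rw [hR]; ring
    rw [e]; nlinarith
  · intro c' h1 h2 hK'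
    have : c' ∈ S := (hSm c').2 fun k hk => ⟨⟨h1.le, h2.le.trans hcR⟩, hK' hk⟩
    exact absurd (hmin this) (not_le.2 h2)
  · intro y hy
    obtain ⟨p, hp, hy⟩ := mem_cp.1 hy
    obtain ⟨p', hp', hk⟩ := mem_cp.1 (hcS' k0 hk0).2
    have h1 : dist y k0 ≤ R * (2 * B) := by
      rw [dist_eq_norm, hy, hk, add_sub_add_left_eq_sub, ← smul_sub, norm_smul, Real.norm_of_nonneg hpos.le]
      have : ‖p - p'‖ ≤ 2 * B := (norm_sub_le _ _).trans (by linarith [hB p hp, hB p' hp'])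
      exact mul_le_mul hcR this (norm_nonneg _) hR0.le
    have h2 : dist k0 x ≤ r := hK hk0
    rw [Metric.mem_closedBall]
    have h3 := dist_triangle y k0 x
    have e : R * (2 * B) = 2 * B / δ * r := by rw [hR]; ring
    have : 0 ≤ 1 / δ * r := by positivity
    nlinarith

/-- cross product -/
def cr (u w : E2) : ℝ := u 0 * w 1 - u 1 * w 0

theorem cr_id (u w v : E2) : cr u w • v = cr v w • u + cr u v • w := by
  ext i
  fin_cases i <;> simp [cr] <;> ring

theorem support_fun {P : Set E2} (hconv : Convex ℝ P) (hPi : (interior P).Nonempty) {z : E2}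
    (hz : z ∉ interior P) : ∃ g : E2 →L[ℝ] ℝ, (∀ x ∈ P, g x ≤ g z) ∧ ∀ x ∈ interior P, g x < g z := by
  obtain ⟨g, hg⟩ := geometric_hahn_banach_open_point hconv.interior isOpen_interior hz
  refine ⟨g, ?_, hg⟩
  intro x hx
  have h1 : x ∈ closure (interior P) := by
    rw [hconv.closure_interior_eq_closure_of_nonempty_interior hPi]; exact subset_closure hx
  have : closure (interior P) ⊆ {y | g y ≤ g z} :=
    closure_minimal (fun y hy => (hg y hy).le) (isClosed_le g.continuous continuous_const)
  exact this h1

theorem arith0 {α β a b : ℝ} (hα : 0 < α) (hβ : 0 < β) (ha : a ≤ 0) (hb : b ≤ 0)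
    (h : α * a + β * b = 0) : a = 0 ∧ b = 0 := by
  have h1 : α * a ≤ 0 := mul_nonpos_of_nonneg_of_nonpos hα.le ha
  have h2 : β * b ≤ 0 := mul_nonpos_of_nonneg_of_nonpos hβ.le hb
  have h3 : α * a = 0 := by linarith
  have h4 : β * b = 0 := by linarith
  exact ⟨(mul_eq_zero.1 h3).resolve_left hα.ne', (mul_eq_zero.1 h4).resolve_left hβ.ne'⟩

theorem arith1 {α β g1 g2 g3 : ℝ} (hα : 0 < α) (hβ : 0 < β) (hs : α + β < 1)
    (b1 : g1 ≤ g2) (b3 : g3 ≤ g2) (b2 : 0 ≤ g2) (e : g2 = α * g1 + β * g3) : g1 = 0 ∧ g3 = 0 := by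
  have h1 := mul_le_mul_of_nonneg_left b1 hα.le
  have h3 := mul_le_mul_of_nonneg_left b3 hβ.le
  have z2 : g2 = 0 := by nlinarith
  exact arith0 hα hβ (by linarith) (by linarith) (by linarith)

theorem arith2 {α β g1 g2 g3 : ℝ} (hα : 0 < α) (hβ : 0 < β) (hs : 1 < α + β)
    (b1 : g1 ≤ g2) (b3 : g3 ≤ g2) (b2 : g2 ≤ 0) (e : g2 = α * g1 + β * g3) : g1 = 0 ∧ g3 = 0 := by
  have h1 := mul_le_mul_of_nonneg_left b1 hα.le
  have h3 := mul_le_mul_of_nonneg_left b3 hβ.le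
  have z2 : g2 = 0 := by nlinarith
  exact arith0 hα hβ (by linarith) (by linarith) (by linarith)

/-- the middle lemma, vectors relative to c -/
theorem mid_lemma {P : Set E2} (hconv : Convex ℝ P) (hPi : (interior P).Nonempty) {μ : ℝ} (hμ : 1 < μ)
    {c : E2} {f : E2 →L[ℝ] ℝ} {u1 u2 u3 : E2} (h1 : c + u1 ∈ P) (h3 : c + u3 ∈ P)
    (h1' : c + μ • u1 ∈ P) (h3' : c + μ • u3 ∈ P) (h2 : c + u2 ∈ P) (h2' : c + μ • u2 ∈ P)
    (n2 : c + u2 ∉ interior P) (n2' : c + μ • u2 ∉ interior P)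
    (f1 : 0 < f u1) (f2 : 0 < f u2) (f3 : 0 < f u3)
    (hd : 0 < cr u1 u2 * cr u2 u3) : cr u1 u2 + cr u2 u3 = cr u1 u3 := by
  have hid := cr_id u1 u3 u2
  have hf : cr u1 u3 * f u2 = cr u2 u3 * f u1 + cr u1 u2 * f u3 := by
    have := congrArg f hid
    simpa using this
  obtain ⟨α, β, hα, hβ, hu2, hd13, hα', hβ'⟩ : ∃ α β : ℝ, 0 < α ∧ 0 < β ∧ u2 = α • u1 + β • u3 ∧
      cr u1 u3 ≠ 0 ∧ cr u2 u3 = α * cr u1 u3 ∧ cr u1 u2 = β * cr u1 u3 := by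
    have key : 0 < cr u2 u3 / cr u1 u3 ∧ 0 < cr u1 u2 / cr u1 u3 ∧ cr u1 u3 ≠ 0 := by
      rcases pos_and_pos_or_neg_and_neg_of_mul_pos hd with ⟨p, q⟩ | ⟨p, q⟩
      · have : 0 < cr u1 u3 := by
          have : 0 < cr u1 u3 * f u2 := by rw [hf]; positivity
          exact (pos_iff_pos_of_mul_pos this).2 f2
        exact ⟨div_pos q this, div_pos p this, this.ne'⟩
      · have : cr u1 u3 < 0 := by
          by_contra hh
          push Not at hh
          nlinarith [mul_nonneg hh f2.le]
        exact ⟨div_pos_of_neg_of_neg q this, div_pos_of_neg_of_neg p this, this.ne⟩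
    obtain ⟨k1, k2, k3⟩ := key
    refine ⟨_, _, k1, k2, ?_, k3, by field_simp, by field_simp⟩
    have := congrArg (fun w => (cr u1 u3)⁻¹ • w) hid
    simp only [smul_smul, smul_add, inv_mul_cancel₀ k3, one_smul] at this
    rw [div_eq_inv_mul, div_eq_inv_mul]; exact this
  have hspan : ∀ g : E2 →L[ℝ] ℝ, g u1 = 0 → g u3 = 0 → ∀ v, g v = 0 := by
    intro g e1 e3 v
    have := congrArg g (cr_id u1 u3 v)
    simp [e1, e3] at this
    exact this.resolve_left hd13
  obtain ⟨q, hq⟩ := hPi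
  have hsum : α + β = 1 := by
    rcases lt_trichotomy (α + β) 1 with hlt | heq | hgt
    · exfalso
      obtain ⟨g, hg, hgi⟩ := support_fun hconv ⟨q, hq⟩ n2'
      have a1 := hg _ h1'
      have a3 := hg _ h3'
      have a2 := hg _ h2
      have e2 : g u2 = α * g u1 + β * g u3 := by rw [hu2]; simp
      simp only [map_add, map_smul, smul_eq_mul, add_le_add_iff_left] at a1 a2 a3
      obtain ⟨z1, z3⟩ := arith1 hα hβ hlt (le_of_mul_le_mul_left a1 (by linarith)) (le_of_mul_le_mul_left a3 (by linarith)) (by nlinarith) e2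
      have := hgi q hq
      rw [hspan g z1 z3, hspan g z1 z3] at this
      exact lt_irrefl _ this
    · exact heq
    · exfalso
      obtain ⟨g, hg, hgi⟩ := support_fun hconv ⟨q, hq⟩ n2
      have a1 := hg _ h1
      have a3 := hg _ h3
      have a2 := hg _ h2'
      have e2 : g u2 = α * g u1 + β * g u3 := by rw [hu2]; simp
      simp only [map_add, map_smul, smul_eq_mul, add_le_add_iff_left] at a1 a2 a3
      obtain ⟨z1, z3⟩ := arith2 hα hβ hgt a1 a3 (by nlinarith) e2
      have := hgi q hq
      rw [hspan g z1 z3, hspan g z1 z3] at this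
      exact lt_irrefl _ this
  rw [hα', hβ', ← add_mul, add_comm β, hsum, one_mul]


/-- covered by countably many lines -/
def LN (s : Set E2) : Prop := ∃ S : Set (E2 × E2), S.Countable ∧ (∀ l ∈ S, l.2 ≠ 0) ∧
  ∀ x ∈ s, ∃ l ∈ S, cr (x - l.1) l.2 = 0

theorem LN.mono {s t : Set E2} (h : s ⊆ t) (ht : LN t) : LN s := by
  obtain ⟨S, h1, h2, h3⟩ := ht
  exact ⟨S, h1, h2, fun x hx => h3 x (h hx)⟩

theorem LN.biUnion {ι : Type*} {T : Set ι} (hT : T.Countable) {f : ι → Set E2}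
    (h : ∀ i ∈ T, LN (f i)) : LN (⋃ i ∈ T, f i) := by
  choose! S h1 h2 h3 using h
  refine ⟨⋃ i ∈ T, S i, hT.biUnion h1, ?_, ?_⟩
  · intro l hl
    simp only [mem_iUnion] at hl
    obtain ⟨i, hi, hl⟩ := hl
    exact h2 i hi l hl
  · intro x hx
    simp only [mem_iUnion] at hx
    obtain ⟨i, hi, hx⟩ := hx
    obtain ⟨l, hl, hx⟩ := h3 i hi x hx
    exact ⟨l, mem_biUnion hi hl, hx⟩

theorem LN.union {s t : Set E2} (hs : LN s) (ht : LN t) : LN (s ∪ t) := by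
  obtain ⟨S, h1, h2, h3⟩ := hs
  obtain ⟨S', h1', h2', h3'⟩ := ht
  refine ⟨S ∪ S', h1.union h1', ?_, ?_⟩
  · rintro l (hl | hl)
    · exact h2 l hl
    · exact h2' l hl
  · rintro x (hx | hx)
    · obtain ⟨l, hl, hx⟩ := h3 x hx
      exact ⟨l, Or.inl hl, hx⟩
    · obtain ⟨l, hl, hx⟩ := h3' x hx
      exact ⟨l, Or.inr hl, hx⟩

theorem LN_subsingleton {s : Set E2} (hs : s.Subsingleton) : LN s := by
  rcases hs.eq_empty_or_singleton with rfl | ⟨a, rfl⟩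
  · exact ⟨∅, by simp, by simp, by simp⟩
  · refine ⟨{(a, !₂[1, 0])}, by simp, ?_, ?_⟩
    · intro l hl
      rw [mem_singleton_iff] at hl
      subst hl
      intro h
      have := congrArg (fun w : E2 => w 0) h
      simp at this
    · intro x hx
      rw [mem_singleton_iff] at hx
      subst hx
      exact ⟨_, rfl, by simp [cr]⟩

theorem fun_eq_cr (f : E2 →L[ℝ] ℝ) : ∃ v : E2, ∀ x, f x = cr x v := by
  refine ⟨!₂[- f (EuclideanSpace.single 1 1), f (EuclideanSpace.single 0 1)], ?_⟩
  intro x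
  have hx : x = x 0 • EuclideanSpace.single 0 1 + x 1 • EuclideanSpace.single 1 1 := by
    ext i; fin_cases i <;> simp
  conv_lhs => rw [hx]
  simp [cr]

theorem cover_lemma {P : Set E2} (hconv : Convex ℝ P) (hPi : (interior P).Nonempty) {μ : ℝ}
    (hμ : 1 < μ) (c : E2) :
    LN {z | z ∈ P ∧ z ∉ interior P ∧ c + μ • (z - c) ∈ P ∧ c + μ • (z - c) ∉ interior P} := by
  by_cases hc : c ∈ interior P
  · refine LN.mono ?_ (LN_subsingleton (s := ∅) (by simp))
    rintro z ⟨h1, h2, h3, h4⟩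
    apply h2
    have hμ0 : μ ≠ 0 := by positivity
    have hi : μ⁻¹ < 1 := inv_lt_one_of_one_lt₀ hμ
    have := hconv.combo_interior_self_mem_interior hc h3 (a := 1 - μ⁻¹) (b := μ⁻¹) (by linarith)
      (by positivity) (by ring)
    convert this using 1
    rw [smul_add, smul_smul, inv_mul_cancel₀ hμ0, one_smul, sub_smul, one_smul]
    abel
  obtain ⟨g, hg, hgi⟩ := support_fun hconv hPi hc
  obtain ⟨v, hv⟩ := fun_eq_cr (-g)
  have hv0 : v ≠ 0 := by
    rintro rfl
    obtain ⟨q, hq⟩ := hPi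
    have h1 := hgi q hq
    have h2 := hv q
    have h3 := hv c
    simp [cr] at h2 h3
    linarith
  by_contra hLN
  have pick : ∀ S : Set (E2 × E2), S.Countable → (∀ l ∈ S, l.2 ≠ 0) → ∃ z, (z ∈ P ∧ z ∉ interior P ∧
      c + μ • (z - c) ∈ P ∧ c + μ • (z - c) ∉ interior P) ∧ ∀ l ∈ S, cr (z - l.1) l.2 ≠ 0 := by
    intro S hS hS0
    by_contra hcon
    push Not at hcon
    exact hLN ⟨S, hS, hS0, hcon⟩
  have cr0 : ∀ w, cr w 0 = 0 := by intro w; simp [cr]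
  have crs : ∀ w, cr w w = 0 := by intro w; simp [cr]; ring
  have anti : ∀ u w, cr u w = - cr w u := by intro u w; simp [cr]; ring
  obtain ⟨z1, ⟨a1, b1, a1', b1'⟩, h1⟩ := pick {(c, v)} (by simp) (by simp [hv0])
  have e1 : cr (z1 - c) v ≠ 0 := h1 _ rfl
  have n1 : z1 - c ≠ 0 := by rintro h; rw [h] at e1; simp [cr] at e1
  obtain ⟨z2, ⟨a2, b2, a2', b2'⟩, h2⟩ := pick {(c, v), (c, z1 - c)} (by simp) (by simp [hv0, n1])
  have e2 : cr (z2 - c) v ≠ 0 := h2 (c, v) (by simp)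
  have d21 : cr (z2 - c) (z1 - c) ≠ 0 := h2 (c, z1 - c) (by simp)
  have n2 : z2 - c ≠ 0 := by rintro h; rw [h] at e2; simp [cr] at e2
  have n21 : z2 - z1 ≠ 0 := by
    rintro h; rw [sub_eq_zero.1 h] at d21; exact d21 (crs _)
  obtain ⟨z3, ⟨a3, b3, a3', b3'⟩, h3⟩ := pick {(c, v), (c, z1 - c), (c, z2 - c), (z1, z2 - z1)}
    (by simp) (by simp [hv0, n1, n2, n21])
  have e3 : cr (z3 - c) v ≠ 0 := h3 (c, v) (by simp)
  have d31 : cr (z3 - c) (z1 - c) ≠ 0 := h3 (c, z1 - c) (by simp)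
  have d32 : cr (z3 - c) (z2 - c) ≠ 0 := h3 (c, z2 - c) (by simp)
  have d : cr (z3 - z1) (z2 - z1) ≠ 0 := h3 (z1, z2 - z1) (by simp)
  have fpos : ∀ z ∈ P, cr (z - c) v ≠ 0 → 0 < (-g) (z - c) := by
    intro z hz hne
    rw [← hv] at hne
    refine lt_of_le_of_ne ?_ hne.symm
    have := hg z hz
    simp; linarith
  have f1 := fpos _ a1 e1
  have f2 := fpos _ a2 e2
  have f3 := fpos _ a3 e3
  set u1 := z1 - c with hu1
  set u2 := z2 - c with hu2
  set u3 := z3 - c with hu3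
  have t1 : c + u1 = z1 := by rw [hu1]; abel
  have t2 : c + u2 = z2 := by rw [hu2]; abel
  have t3 : c + u3 = z3 := by rw [hu3]; abel
  rw [← t1] at a1 b1
  rw [← t2] at a2 b2
  rw [← t3] at a3 b3
  have hdd : cr (z3 - z1) (z2 - z1) = cr u3 u2 - cr u3 u1 - cr u1 u2 := by
    rw [← t1, ← t2, ← t3]; simp [cr]; ring
  rw [hdd] at d
  have A21 := anti u2 u1
  have A31 := anti u3 u1
  have A32 := anti u3 u2
  have p1 : 0 < cr u1 u2 * cr u2 u3 → False := fun hh => by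
    have := mid_lemma hconv hPi hμ a1 a3 a1' a3' a2 a2' b2 b2' f1 f2 f3 hh
    apply d; linarith
  have p2 : 0 < cr u1 u3 * cr u3 u2 → False := fun hh => by
    have := mid_lemma hconv hPi hμ a1 a2 a1' a2' a3 a3' b3 b3' f1 f3 f2 hh
    apply d; linarith
  have p3 : 0 < cr u2 u1 * cr u1 u3 → False := fun hh => by
    have := mid_lemma hconv hPi hμ a2 a3 a2' a3' a1 a1' b1 b1' f2 f1 f3 hh
    apply d; linarith
  rw [A21] at d21 p3
  rw [A31] at d31
  rw [A32] at d32 p2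
  have g1 := neg_ne_zero.1 d21
  have g2 := neg_ne_zero.1 d31
  have g3 := neg_ne_zero.1 d32
  generalize cr u1 u2 = x at *
  generalize cr u2 u3 = y at *
  generalize cr u1 u3 = z at *
  rcases lt_or_gt_of_ne g1 with q1 | q1 <;> rcases lt_or_gt_of_ne g2 with q2 | q2 <;>
    rcases lt_or_gt_of_ne g3 with q3 | q3 <;> first
    | exact p1 (mul_pos q1 q3)
    | exact p1 (mul_pos_of_neg_of_neg q1 q3)
    | exact p2 (mul_pos q2 (by linarith))
    | exact p2 (mul_pos_of_neg_of_neg q2 (by linarith))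
    | exact p3 (mul_pos (by linarith) q2)
    | exact p3 (mul_pos_of_neg_of_neg (by linarith) q2)

/-- kernel lemma -/
theorem kernel_lemma {N : Set E2} (hN : ¬ LN N) : ∃ N' ⊆ N, N'.Nonempty ∧
    ∀ V, IsOpen V → (N' ∩ V).Nonempty → ¬ LN (N' ∩ V) := by
  let G : Set E2 := {x | ∃ V, IsOpen V ∧ x ∈ V ∧ LN (N ∩ V)}
  have hG : LN (N ∩ G) := by
    have : ∀ x ∈ N ∩ G, ∃ V, IsOpen V ∧ x ∈ V ∧ LN (N ∩ V) := fun x hx => hx.2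
    choose! f h1 h2 h3 using this
    obtain ⟨t, hts, htc, ht⟩ := TopologicalSpace.countable_cover_nhdsWithin (s := N ∩ G) (f := f)
      (fun x hx => mem_nhdsWithin_of_mem_nhds ((h1 x hx).mem_nhds (h2 x hx)))
    refine LN.mono ?_ (LN.biUnion htc (f := fun x => N ∩ f x) fun x hx => h3 x (hts hx))
    intro x hx
    have := ht hx
    simp only [mem_iUnion] at this ⊢
    obtain ⟨i, hi, hxi⟩ := this
    exact ⟨i, hi, hx.1, hxi⟩
  refine ⟨N \ G, sdiff_subset, ?_, ?_⟩
  · by_contra h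
    rw [not_nonempty_iff_eq_empty, sdiff_eq_empty] at h
    have h' : N ⊆ N ∩ G := fun x hx => ⟨hx, h hx⟩
    exact hN (LN.mono h' hG)
  · rintro V hV ⟨x, ⟨hxN, hxG⟩, hxV⟩ hLN
    apply hxG
    refine ⟨V, hV, hxV, LN.mono ?_ (hLN.union hG)⟩
    rintro y ⟨hy, hyV⟩
    by_cases h : y ∈ G
    · exact Or.inr ⟨hy, h⟩
    · exact Or.inl ⟨⟨hy, h⟩, hyV⟩


/-- `[q, q+w]` is a longest chord of `P` in its direction -/
def Chord (P : Set E2) (q w : E2) : Prop :=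
  q ∈ P ∧ q + w ∈ P ∧ ∀ p ∈ P, ∀ t : ℝ, p + t • w ∈ P → t ≤ 1

theorem exists_chord {P : Set E2} (hP : IsCompact P) (hPi : (interior P).Nonempty) {v : E2}
    (hv : v ≠ 0) : ∃ (q : E2) (L : ℝ), 0 < L ∧ Chord P q (L • v) := by
  obtain ⟨z0, hz0⟩ := hPi
  obtain ⟨B, hB⟩ := hP.isBounded.exists_norm_le
  have hv' : 0 < ‖v‖ := norm_pos_iff.2 hv
  set M := 2 * B / ‖v‖ with hM
  have hbd : ∀ p ∈ P, ∀ t : ℝ, p + t • v ∈ P → t ≤ M := by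
    intro p hp t ht
    rw [hM, le_div_iff₀ hv']
    have h1 : ‖t • v‖ ≤ 2 * B := by
      have := norm_sub_le (p + t • v) p
      rw [add_sub_cancel_left] at this
      linarith [hB _ hp, hB _ ht]
    rw [norm_smul] at h1
    exact (mul_le_mul_of_nonneg_right (le_abs_self t) hv'.le).trans h1
  let S : Set (E2 × ℝ) := (P ×ˢ Icc 0 M) ∩ {x | x.1 + x.2 • v ∈ P}
  have hS : IsCompact S := (hP.prod isCompact_Icc).inter_right
    (hP.isClosed.preimage (by fun_prop : Continuous fun x : E2 × ℝ => x.1 + x.2 • v))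
  obtain ⟨t0, ht0, hz1⟩ : ∃ t0 : ℝ, 0 < t0 ∧ z0 + t0 • v ∈ P := by
    have hc : Continuous fun t : ℝ => z0 + t • v := by fun_prop
    have : ∀ᶠ t in 𝓝 (0 : ℝ), z0 + t • v ∈ P := by
      apply hc.continuousAt.eventually_mem
      simpa using mem_interior_iff_mem_nhds.1 hz0
    obtain ⟨ε, hε, h⟩ := Metric.eventually_nhds_iff.1 this
    exact ⟨ε / 2, by positivity, h (by rw [Real.dist_eq, sub_zero, abs_of_pos (by positivity)]; linarith)⟩
  have h0 : (z0, t0) ∈ S :=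
    ⟨⟨interior_subset hz0, ht0.le, hbd _ (interior_subset hz0) _ hz1⟩, hz1⟩
  obtain ⟨⟨q, L⟩, hqS, hmax⟩ := hS.exists_isMaxOn ⟨_, h0⟩ continuous_snd.continuousOn
  have hL : 0 < L := lt_of_lt_of_le ht0 (hmax h0)
  refine ⟨q, L, hL, hqS.1.1, hqS.2, ?_⟩
  intro p hp t ht
  rw [smul_smul] at ht
  by_contra hlt
  push Not at hlt
  have h1 : L < t * L := by nlinarith
  have : (p, t * L) ∈ S := ⟨⟨hp, by positivity, hbd p hp _ ht⟩, ht⟩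
  exact absurd (hmax this) (not_le.2 h1)

/-- copy whose long chord is `[a+s w, a+t w]` -/
def cc (a q w : E2) (s t : ℝ) : E2 × ℝ := (a + s • w - (t - s) • q, t - s)

abbrev Win := (E2 × ℝ) × Set E2

def lwin (a q w : E2) (s t : ℝ) : Win := (cc a q w s t, (fun r : ℝ => a + r • w) '' Ioo s t)

theorem mem_cc {P : Set E2} {a q w : E2} {s t : ℝ} {x : E2} :
    x ∈ copySet P (cc a q w s t) ↔ ∃ p ∈ P, x = a + s • w + (t - s) • (p - q) := by
  rw [mem_cp]
  refine exists_congr fun p => and_congr_right fun _ => ?_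
  simp only [cc, smul_sub]
  constructor <;> (rintro rfl; abel)

theorem cc_mono {P : Set E2} (hconv : Convex ℝ P) {a q w : E2} (hq : Chord P q w) {s t s' t' : ℝ}
    (h1 : s ≤ s') (h2 : s' < t') (h3 : t' ≤ t) :
    copySet P (cc a q w s' t') ⊆ copySet P (cc a q w s t) := by
  intro x hx
  obtain ⟨p, hp, rfl⟩ := mem_cc.1 hx
  rw [mem_cc]
  have hT : 0 < t - s := by linarith
  have hT' := hT.ne'
  refine ⟨((s' - s) / (t - s)) • (q + w) + (((t' - s') / (t - s)) • p + ((t - t') / (t - s)) • q), ?_, ?_⟩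
  · have := hconv.sum_mem (t := Finset.univ) (w := ![(s' - s) / (t - s), (t' - s') / (t - s), (t - t') / (t - s)])
      (z := ![q + w, p, q]) ?_ ?_ ?_
    · simpa [Fin.sum_univ_three, add_assoc] using this
    · intro i _
      fin_cases i
      · exact div_nonneg (by linarith) hT.le
      · exact div_nonneg (by linarith) hT.le
      · exact div_nonneg (by linarith) hT.le
    · simp [Fin.sum_univ_three]; field_simp; ring
    · intro i _
      fin_cases i
      · exact hq.2.1
      · exact hp
      · exact hq.1
  · ext i
    simp
    field_simp
    ring

theorem chord_mem {P : Set E2} (hconv : Convex ℝ P) {a q w : E2} (hq : Chord P q w) {s t r : ℝ}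
    (h1 : s < t) (hr : r ∈ Ioo s t) : a + r • w ∈ copySet P (cc a q w s t) := by
  rw [mem_cc]
  have hT : 0 < t - s := by linarith
  have hT' := hT.ne'
  refine ⟨((t - r) / (t - s)) • q + ((r - s) / (t - s)) • (q + w),
    hconv hq.1 hq.2.1 (div_nonneg (by linarith [hr.2]) hT.le) (div_nonneg (by linarith [hr.1]) hT.le) (by field_simp; ring), ?_⟩
  ext i
  simp
  field_simp
  ring

theorem line_cover {P : Set E2} (hP : IsCompact P) {a q w : E2}
    (hq : Chord P q w) {O : Set E2} (hO : IsOpen O) {I : Set ℝ} (hI : IsOpen I)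
    (τ : Win → E2 × ℝ) (hτ : ∀ W : Win, 0 < W.1.2 → 0 < (τ W).2 ∧ (τ W).2 < W.1.2) :
    ∃ T : Set (ℝ × ℝ), T.Countable ∧ (∀ p ∈ T, p.1 < p.2 ∧ Icc p.1 p.2 ⊆ I ∧
      copySet P (cc a q w p.1 p.2) ⊆ O) ∧
      {r | r ∈ I ∧ a + r • w ∈ O ∧ ∀ p ∈ T, ¬ (r ∈ Ioo p.1 p.2 ∧
        a + r • w ∉ copySet P (τ (lwin a q w p.1 p.2)))}.Countable := by
  let φ : ℝ → E2 := fun r => a + r • w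
  have hφ : Continuous φ := by fun_prop
  let Q : Set (ℝ × ℝ) := {p | p.1 < p.2 ∧ Icc p.1 p.2 ⊆ I ∧ copySet P (cc a q w p.1 p.2) ⊆ O}
  let U : ℝ × ℝ → Set ℝ := fun p => Ioo p.1 p.2 ∩ φ ⁻¹' (copySet P (τ (lwin a q w p.1 p.2)))ᶜ
  obtain ⟨T, hTQ, hTc, hTU⟩ := TopologicalSpace.isOpen_biUnion_countable Q U
    (fun p _ => isOpen_Ioo.inter ((isClosed_copy hP _).isOpen_compl.preimage hφ))
  refine ⟨T, hTc, fun p hp => hTQ hp, ?_⟩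
  set M := {r | r ∈ I ∧ a + r • w ∈ O ∧ ∀ p ∈ T, ¬ (r ∈ Ioo p.1 p.2 ∧
        a + r • w ∉ copySet P (τ (lwin a q w p.1 p.2)))} with hM
  have hMQ : ∀ r ∈ M, ∀ p ∈ Q, r ∈ Ioo p.1 p.2 → φ r ∈ copySet P (τ (lwin a q w p.1 p.2)) := by
    intro r hr p hp hrp
    by_contra hcon
    have : r ∈ ⋃ p ∈ Q, U p := mem_biUnion hp ⟨hrp, hcon⟩
    rw [← hTU] at this
    simp only [mem_iUnion] at this
    obtain ⟨p', hp', h⟩ := this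
    exact hr.2.2 p' hp' h
  by_contra hunc
  let M1 := (M \ {x ∈ M | 𝓝[M ∩ Ioi x] x = ⊥}) \ {x ∈ M | 𝓝[M ∩ Iio x] x = ⊥}
  have c1 := countable_setOfPred_isolated_right_within (s := M)
  have c2 := countable_setOfPred_isolated_left_within (s := M)
  have hM1 : ¬ M1.Countable := by
    intro h
    apply hunc
    refine ((h.union c1).union c2).mono ?_
    intro x hx
    by_cases h1 : x ∈ {x ∈ M | 𝓝[M ∩ Ioi x] x = ⊥}
    · exact Or.inl (Or.inr h1)
    by_cases h2 : x ∈ {x ∈ M | 𝓝[M ∩ Iio x] x = ⊥}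
    · exact Or.inr h2
    · exact Or.inl (Or.inl ⟨⟨hx, h1⟩, h2⟩)
  have c3 := countable_setOfPred_isolated_right_within (s := M1)
  obtain ⟨s, hs1, hs2⟩ : ∃ s ∈ M1, 𝓝[M1 ∩ Ioi s] s ≠ ⊥ := by
    by_contra hcon
    push Not at hcon
    have hsub : M1 ⊆ {x ∈ M1 | 𝓝[M1 ∩ Ioi x] x = ⊥} := fun x hx => ⟨hx, hcon x hx⟩
    exact hM1 (c3.mono hsub)
  have hsM : s ∈ M := hs1.1.1
  have right : ∀ (X : Set ℝ) (x : ℝ), 𝓝[X ∩ Ioi x] x ≠ ⊥ → ∀ ε > 0, ∃ y ∈ X, x < y ∧ y < x + ε := by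
    intro X x hne ε hε
    have : (𝓝[X ∩ Ioi x] x).NeBot := ⟨hne⟩
    have h1 : Iio (x + ε) ∈ 𝓝[X ∩ Ioi x] x := mem_nhdsWithin_of_mem_nhds (Iio_mem_nhds (by linarith))
    obtain ⟨y, hy1, hy2⟩ := Filter.nonempty_of_mem (Filter.inter_mem h1 self_mem_nhdsWithin)
    exact ⟨y, hy2.1, hy2.2, hy1⟩
  have left : ∀ (X : Set ℝ) (x : ℝ), 𝓝[X ∩ Iio x] x ≠ ⊥ → ∀ ε > 0, ∃ y ∈ X, y < x ∧ x - ε < y := by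
    intro X x hne ε hε
    have : (𝓝[X ∩ Iio x] x).NeBot := ⟨hne⟩
    have h1 : Ioi (x - ε) ∈ 𝓝[X ∩ Iio x] x := mem_nhdsWithin_of_mem_nhds (Ioi_mem_nhds (by linarith))
    obtain ⟨y, hy1, hy2⟩ := Filter.nonempty_of_mem (Filter.inter_mem h1 self_mem_nhdsWithin)
    exact ⟨y, hy2.1, hy2.2, hy1⟩
  -- legality of small copies
  obtain ⟨ε, hε, hleg⟩ : ∃ ε > 0, ∀ t, s < t → t < s + ε → (s, t) ∈ Q := by
    obtain ⟨ε1, hε1, hI1⟩ := Metric.isOpen_iff.1 hI s hsM.1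
    obtain ⟨ε2, hε2, hO1⟩ := Metric.isOpen_iff.1 hO _ hsM.2.1
    obtain ⟨B, hB⟩ := hP.isBounded.exists_norm_le
    have hB0 : 0 ≤ B := (norm_nonneg _).trans (hB q hq.1)
    refine ⟨min ε1 (ε2 / (2 * B + 1)), by positivity, ?_⟩
    intro t ht1 ht2
    have k1 := min_le_left ε1 (ε2 / (2 * B + 1))
    have k2 := min_le_right ε1 (ε2 / (2 * B + 1))
    refine ⟨ht1, ?_, ?_⟩
    · intro y hy
      apply hI1
      rw [Metric.mem_ball, Real.dist_eq, abs_of_nonneg (by linarith [hy.1])]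
      have := hy.2
      simp only at this
      linarith
    · intro x hx
      obtain ⟨p, hp, rfl⟩ := mem_cc.1 hx
      apply hO1
      rw [Metric.mem_ball, dist_eq_norm, add_sub_cancel_left, norm_smul, Real.norm_of_nonneg (by simp; linarith)]
      have h1 : ‖p - q‖ ≤ 2 * B := (norm_sub_le _ _).trans (by linarith [hB p hp, hB q hq.1])
      have h2 : t - s < ε2 / (2 * B + 1) := by linarith
      rw [lt_div_iff₀ (by positivity)] at h2
      simp only
      nlinarith
  obtain ⟨t, ht1, hst, ht2⟩ := right M1 s hs2 ε hε
  have hQ := hleg t hst ht2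
  set W := lwin a q w s t with hW
  have hW2 : W.1.2 = t - s := rfl
  obtain ⟨hρ0, hρ⟩ := hτ W (by rw [hW2]; linarith)
  rw [hW2] at hρ
  have hsr : 𝓝[M ∩ Ioi s] s ≠ ⊥ := fun h => hs1.1.2 ⟨hsM, h⟩
  have htl : 𝓝[M ∩ Iio t] t ≠ ⊥ := fun h => ht1.2 ⟨ht1.1.1, h⟩
  set η := (t - s - (τ W).2) / 3 with hη
  have hη0 : 0 < η := by rw [hη]; linarith
  obtain ⟨r1, hr1M, hr1, hr1'⟩ := right M s hsr η hη0
  obtain ⟨r2, hr2M, hr2, hr2'⟩ := left M t htl η hη0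
  have m1 := hMQ r1 hr1M (s, t) hQ ⟨hr1, by simp only; linarith⟩
  have m2 := hMQ r2 hr2M (s, t) hQ ⟨by simp only; linarith, hr2⟩
  rw [mem_cp' hρ0] at m1 m2
  have := hq.2.2 _ m1 ((r2 - r1) / (τ W).2) (by
    convert m2 using 1
    ext i
    simp [φ]
    field_simp
    ring)
  rw [div_le_one hρ0] at this
  linarith


theorem cr_zero {u v : E2} (hv : v ≠ 0) (h : cr u v = 0) : ∃ r : ℝ, u = r • v := by
  unfold cr at h
  by_cases h0 : v 0 = 0
  · have h1 : v 1 ≠ 0 := by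
      intro h1
      apply hv
      ext i
      fin_cases i
      · simpa using h0
      · simpa using h1
    refine ⟨u 1 / v 1, ?_⟩
    have : u 0 = 0 := by
      rw [h0] at h
      simpa [h1] using h
    ext i
    fin_cases i
    · simp [h0, this]
    · simp; field_simp
  · refine ⟨u 0 / v 0, ?_⟩
    ext i
    fin_cases i
    · simp; field_simp
    · simp; field_simp; linarith

theorem LN_image {Z : Set E2} (hZ : LN Z) (b : E2) {ρ : ℝ} (hρ : 0 < ρ) {s : Set E2}
    (hs : ∀ x ∈ s, ρ⁻¹ • (x - b) ∈ Z) : LN s := by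
  obtain ⟨S, h1, h2, h3⟩ := hZ
  refine ⟨(fun l : E2 × E2 => (b + ρ • l.1, l.2)) '' S, h1.image _, ?_, ?_⟩
  · rintro _ ⟨l, hl, rfl⟩
    exact h2 l hl
  · intro x hx
    obtain ⟨l, hl, h⟩ := h3 _ (hs x hx)
    refine ⟨_, ⟨l, hl, rfl⟩, ?_⟩
    have : cr (x - (b + ρ • l.1)) l.2 = ρ * cr (ρ⁻¹ • (x - b) - l.1) l.2 := by
      simp [cr]
      field_simp
      ring
    simp only
    rw [this, h, mul_zero]

theorem rest_LN {P : Set E2} (hP : IsCompact P) (hconv : Convex ℝ P) (hPi : (interior P).Nonempty)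
    {O : Set E2} (hO : IsOpen O) (τ : E2 × ℝ → E2 × ℝ)
    (hτ : ∀ c : E2 × ℝ, 0 < c.2 → 0 < (τ c).2 ∧ (τ c).2 < c.2) :
    LN {x | x ∈ O ∧ ∀ c : E2 × ℝ, 0 < c.2 → copySet P c ⊆ O →
      ¬ (x ∈ interior (copySet P c) ∧ x ∉ copySet P (τ c))} := by
  by_contra hN
  obtain ⟨N, hNsub, ⟨x0, hx0⟩, hNV⟩ := kernel_lemma hN
  obtain ⟨C, hC, hmin⟩ := min_copy hP hPi
  have step : ∀ V, IsOpen V → V ⊆ O → (N ∩ V).Nonempty → ∀ ε > 0, ∃ c : E2 × ℝ, 0 < c.2 ∧ c.2 < ε ∧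
      ∃ V', IsOpen V' ∧ V' ⊆ V ∧ (N ∩ V').Nonempty ∧
        N ∩ V' ⊆ copySet P c \ interior (copySet P c) := by
    rintro V hV hVO ⟨x, hxN, hxV⟩ ε hε
    obtain ⟨δ, hδ, hball⟩ := Metric.isOpen_iff.1 hV x hxV
    let r := min (ε / (2 * C)) (min (δ / (2 * C)) (δ / 2))
    have hr : 0 < r := by positivity
    have hr1 : C * r ≤ ε / 2 := by
      calc C * r ≤ C * (ε / (2 * C)) := mul_le_mul_of_nonneg_left (min_le_left _ _) hC.le
        _ = ε / 2 := by field_simp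
    have hr2 : C * r ≤ δ / 2 := by
      calc C * r ≤ C * (δ / (2 * C)) :=
            mul_le_mul_of_nonneg_left ((min_le_right _ _).trans (min_le_left _ _)) hC.le
        _ = δ / 2 := by field_simp
    have hr3 : r ≤ δ / 2 := (min_le_right _ _).trans (min_le_right _ _)
    let K := N ∩ Metric.ball x r
    have hKn : K.Nontrivial := by
      rw [← Set.not_subsingleton_iff]
      intro h
      exact hNV _ Metric.isOpen_ball ⟨x, hxN, Metric.mem_ball_self hr⟩ (LN_subsingleton h)
    obtain ⟨c, hc0, hcr, hKc, hcmin, hcb⟩ := hmin x r hr K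
      (fun y hy => Metric.ball_subset_closedBall hy.2) hKn
    have hcO : copySet P c ⊆ O := fun y hy => hVO (hball (by
      have := hcb hy
      rw [Metric.mem_closedBall] at this
      rw [Metric.mem_ball]; linarith))
    obtain ⟨t1, t2⟩ := hτ c hc0
    have hne := hcmin (τ c) t1 t2
    rw [not_subset] at hne
    obtain ⟨y, hyK, hyτ⟩ := hne
    refine ⟨c, hc0, by linarith, Metric.ball x r ∩ (copySet P (τ c))ᶜ,
      Metric.isOpen_ball.inter (isClosed_copy hP _).isOpen_compl, ?_, ⟨y, hyK.1, hyK.2, hyτ⟩, ?_⟩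
    · intro z hz
      apply hball
      have := hz.1
      rw [Metric.mem_ball] at this ⊢
      linarith
    · rintro z ⟨hzN, hzb, hzτ⟩
      refine ⟨hKc ⟨hzN, hzb⟩, fun hzi => ?_⟩
      exact (hNsub hzN).2 c hc0 hcO ⟨hzi, hzτ⟩
  obtain ⟨c1, p1, -, V1, o1, s1, n1, f1⟩ := step O hO subset_rfl ⟨x0, hx0, (hNsub hx0).1⟩ 1 one_pos
  obtain ⟨c2, p2, lt, V2, o2, s2, n2, f2⟩ := step V1 o1 s1 n1 c1.2 p1
  apply hNV V2 o2 n2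
  have hμ : 1 < c1.2 / c2.2 := by rw [one_lt_div p2]; exact lt
  set μ := c1.2 / c2.2 with hμd
  -- fixed point of z ↦ μ z + b
  set b : E2 := c2.2⁻¹ • (c1.1 - c2.1) with hb
  set c : E2 := -((μ - 1)⁻¹ • b) with hc
  have hfix : ∀ z : E2, c + μ • (z - c) = μ • z + b := by
    intro z
    have hm : μ - 1 ≠ 0 := by linarith
    ext i
    simp [hc]
    field_simp
    ring
  refine LN_image (cover_lemma hconv hPi hμ c) c1.1 p1 ?_
  intro x hx
  have h1 := f1 ⟨hx.1, s2 hx.2⟩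
  have h2 := f2 hx
  rw [interior_copy p1, Set.mem_sdiff, mem_cp' p1, mem_cp' p1] at h1
  rw [interior_copy p2, Set.mem_sdiff, mem_cp' p2, mem_cp' p2] at h2
  have e : c + μ • (c1.2⁻¹ • (x - c1.1) - c) = c2.2⁻¹ • (x - c2.1) := by
    rw [hfix, hb, hμd]
    ext i
    simp
    field_simp
    ring
  refine ⟨h1.1, h1.2, ?_, ?_⟩
  · rw [e]; exact h2.1
  · rw [e]; exact h2.2

def Good (P : Set E2) (W : Win) : Prop :=
  0 < W.1.2 ∧ W.2 ⊆ copySet P W.1 ∧ (W.2 = interior (copySet P W.1) ∨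
    ∃ a q w s t, s < t ∧ Chord P q w ∧ W = lwin a q w s t)

theorem good_lwin {P : Set E2} (hconv : Convex ℝ P) {a q w : E2} {s t : ℝ} (hst : s < t)
    (hq : Chord P q w) : Good P (lwin a q w s t) := by
  refine ⟨by simp [lwin, cc, hst], ?_, Or.inr ⟨a, q, w, s, t, hst, hq, rfl⟩⟩
  rintro _ ⟨r, hr, rfl⟩
  exact chord_mem hconv hq hst hr

theorem open_cover {P : Set E2} (hP : IsCompact P) (hconv : Convex ℝ P) (hPi : (interior P).Nonempty)
    {O : Set E2} (hO : IsOpen O) (τ : Win → E2 × ℝ)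
    (hτ : ∀ W : Win, 0 < W.1.2 → 0 < (τ W).2 ∧ (τ W).2 < W.1.2) :
    ∃ S : Set Win, S.Countable ∧ (∀ W ∈ S, Good P W ∧ copySet P W.1 ⊆ O) ∧
      {x | x ∈ O ∧ ∀ W ∈ S, ¬ (x ∈ W.2 ∧ x ∉ copySet P (τ W))}.Countable := by
  let ow : E2 × ℝ → Win := fun c => (c, interior (copySet P c))
  let Q : Set (E2 × ℝ) := {c | 0 < c.2 ∧ copySet P c ⊆ O}
  let U : E2 × ℝ → Set E2 := fun c => interior (copySet P c) ∩ (copySet P (τ (ow c)))ᶜ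
  obtain ⟨T, hTQ, hTc, hTU⟩ := TopologicalSpace.isOpen_biUnion_countable Q U
    (fun p _ => isOpen_interior.inter (isClosed_copy hP _).isOpen_compl)
  obtain ⟨S, hS, hS0, hSN⟩ := rest_LN hP hconv hPi hO (fun c => τ (ow c)) (fun c hc => hτ (ow c) hc)
  have : ∀ l ∈ S, ∃ (q w : E2) (T : Set (ℝ × ℝ)), Chord P q w ∧ (∃ L : ℝ, 0 < L ∧ w = L • l.2) ∧
      T.Countable ∧ (∀ p ∈ T, p.1 < p.2 ∧ copySet P (cc l.1 q w p.1 p.2) ⊆ O) ∧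
      {r : ℝ | l.1 + r • w ∈ O ∧ ∀ p ∈ T, ¬ (r ∈ Ioo p.1 p.2 ∧
        l.1 + r • w ∉ copySet P (τ (lwin l.1 q w p.1 p.2)))}.Countable := by
    intro l hl
    obtain ⟨q, L, hL, hq⟩ := exists_chord hP hPi (hS0 l hl)
    obtain ⟨T, h1, h2, h3⟩ := line_cover hP (a := l.1) hq hO isOpen_univ τ hτ
    exact ⟨q, L • l.2, T, hq, ⟨L, hL, rfl⟩, h1, fun p hp => ⟨(h2 p hp).1, (h2 p hp).2.2⟩,
      by simpa using h3⟩
  choose! q w TT hq hw hTTc hTT hexc using this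
  refine ⟨ow '' T ∪ ⋃ l ∈ S, (fun p : ℝ × ℝ => lwin l.1 (q l) (w l) p.1 p.2) '' TT l,
    (hTc.image _).union (hS.biUnion fun l hl => (hTTc l hl).image _), ?_, ?_⟩
  · rintro W (⟨c, hc, rfl⟩ | hW)
    · exact ⟨⟨(hTQ hc).1, interior_subset, Or.inl rfl⟩, (hTQ hc).2⟩
    · simp only [mem_iUnion] at hW
      obtain ⟨l, hl, p, hp, rfl⟩ := hW
      exact ⟨good_lwin hconv (hTT l hl p hp).1 (hq l hl), (hTT l hl p hp).2⟩
  · refine (hS.biUnion fun l hl => (hexc l hl).image (fun r : ℝ => l.1 + r • w l)).mono ?_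
    rintro x ⟨hxO, hx⟩
    obtain ⟨l, hl, hxl⟩ := hSN x ⟨hxO, fun c hc hcO hcon => by
      have : x ∈ ⋃ c ∈ Q, U c := mem_biUnion (show c ∈ Q from ⟨hc, hcO⟩) hcon
      rw [← hTU] at this
      simp only [mem_iUnion] at this
      obtain ⟨c', hc', h⟩ := this
      exact hx (ow c') (Or.inl ⟨c', hc', rfl⟩) h⟩
    obtain ⟨r, hr⟩ := cr_zero (hS0 l hl) hxl
    obtain ⟨L, hL, hwL⟩ := hw l hl
    have hxe : x = l.1 + (r / L) • w l := by
      rw [hwL, smul_smul, div_mul_cancel₀ _ hL.ne', ← hr]; abel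
    refine mem_biUnion hl ⟨r / L, ⟨?_, ?_⟩, hxe.symm⟩
    · rw [← hxe]; exact hxO
    · rintro p hp ⟨h1, h2⟩
      rw [← hxe] at h2
      refine hx (lwin l.1 (q l) (w l) p.1 p.2) (Or.inr (mem_biUnion hl ⟨p, hp, rfl⟩)) ⟨?_, h2⟩
      exact ⟨r / L, h1, hxe.symm⟩

theorem step_cover {P : Set E2} (hP : IsCompact P) (hconv : Convex ℝ P) (hPi : (interior P).Nonempty)
    {W0 : Win} (hW0 : Good P W0) (c1 : E2 × ℝ) (τ : Win → E2 × ℝ)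
    (hτ : ∀ W : Win, 0 < W.1.2 → 0 < (τ W).2 ∧ (τ W).2 < W.1.2) :
    ∃ S : Set Win, S.Countable ∧ (∀ W ∈ S, Good P W ∧ copySet P W.1 ⊆ copySet P W0.1 \ copySet P c1) ∧
      {x | (x ∈ W0.2 ∧ x ∉ copySet P c1) ∧ ∀ W ∈ S, ¬ (x ∈ W.2 ∧ x ∉ copySet P (τ W))}.Countable := by
  obtain ⟨h0, hsub, h | ⟨a, q, w, s, t, hst, hq, rfl⟩⟩ := hW0
  · obtain ⟨S, h1, h2, h3⟩ := open_cover hP hconv hPi (O := interior (copySet P W0.1) ∩ (copySet P c1)ᶜ)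
      (isOpen_interior.inter (isClosed_copy hP _).isOpen_compl) τ hτ
    refine ⟨S, h1, fun W hW => ⟨(h2 W hW).1, fun x hx => ?_⟩, ?_⟩
    · exact ⟨interior_subset ((h2 W hW).2 hx).1, ((h2 W hW).2 hx).2⟩
    · rw [h]; exact h3
  · obtain ⟨T, h1, h2, h3⟩ := line_cover hP (a := a) hq (isClosed_copy hP c1).isOpen_compl
      (isOpen_Ioo (a := s) (b := t)) τ hτ
    refine ⟨(fun p : ℝ × ℝ => lwin a q w p.1 p.2) '' T, h1.image _, ?_, ?_⟩
    · rintro _ ⟨p, hp, rfl⟩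
      obtain ⟨k1, k2, k3⟩ := h2 p hp
      refine ⟨good_lwin hconv k1 hq, fun x hx => ⟨?_, k3 hx⟩⟩
      exact cc_mono hconv hq (k2 (left_mem_Icc.2 k1.le)).1.le k1 (k2 (right_mem_Icc.2 k1.le)).2.le hx
    · refine (h3.image (fun r : ℝ => a + r • w)).mono ?_
      rintro x ⟨⟨⟨r, hr, rfl⟩, hx1⟩, hx⟩
      refine ⟨r, ⟨hr, hx1, ?_⟩, rfl⟩
      rintro p hp ⟨k1, k2⟩
      exact hx _ ⟨p, hp, rfl⟩ ⟨⟨r, k1, rfl⟩, k2⟩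


theorem rule_odd {P : Set E2} {m : ℕ → E2 × ℝ} {k : ℕ} :
    Rule P m (2 * k + 1) ↔ 0 < (m (2 * k + 1)).2 ∧ (m (2 * k + 1)).2 < (m (2 * k)).2 := by
  have h : (2 * k + 1) % 2 = 1 := by omega
  simp [Rule, h]

theorem rule_zero {P : Set E2} {m : ℕ → E2 × ℝ} : Rule P m 0 ↔ 0 < (m 0).2 := by
  simp [Rule]

theorem rule_even {P : Set E2} {m : ℕ → E2 × ℝ} {k : ℕ} :
    Rule P m (2 * (k + 1)) ↔ 0 < (m (2 * (k + 1))).2 ∧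
      copySet P (m (2 * (k + 1))) ⊆ copySet P (m (2 * k)) \ copySet P (m (2 * k + 1)) := by
  have h : ¬ ((2 * (k + 1)) % 2 = 1) := by omega
  have h1 : 2 * (k + 1) - 2 = 2 * k := by omega
  have h2 : 2 * (k + 1) - 1 = 2 * k + 1 := by omega
  have h3 : 2 * (k + 1) ≠ 0 := by omega
  simp only [Rule, h, if_false, h1, h2]
  simp

theorem getD_ofFn' (m : ℕ → E2 × ℝ) {n i : ℕ} (hi : i < n) (d : E2 × ℝ) :
    (List.ofFn fun i : Fin n => m i).getD i d = m i := by
  rw [List.getD_eq_getElem _ _ (by simpa using hi)]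
  simp

theorem countable_II {P A : Set E2} (hPn : P.Nonempty) (hA : A.Countable) :
    ∃ σ, WinningII P A σ := by
  obtain ⟨f, hf⟩ := Set.countable_iff_exists_subset_range.1 hA
  obtain ⟨p, hp⟩ := hPn
  refine ⟨fun l => (f (l.length / 2) - ((l.getD (l.length - 1) 0).2 / 2) • p,
    (l.getD (l.length - 1) 0).2 / 2), ?_⟩
  intro m hm
  have key : ∀ n, m (2 * n + 1) = (f n - ((m (2 * n)).2 / 2) • p, (m (2 * n)).2 / 2) := by
    intro n
    have h := hm n
    simp only [List.length_ofFn] at h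
    rw [show 2 * n + 1 - 1 = 2 * n by omega, show (2 * n + 1) / 2 = n by omega,
      getD_ofFn' m (by omega)] at h
    exact h
  refine ⟨?_, ?_⟩
  · intro n hn
    have := (hn (2 * n) (by omega)).1
    rw [rule_odd, key n]
    constructor <;> simp only <;> linarith
  · intro hr
    rw [Set.eq_empty_iff_forall_notMem]
    rintro x ⟨hx, hxA⟩
    obtain ⟨n, rfl⟩ := hf hxA
    have h1 := (rule_even.1 (hr (2 * (n + 1)))).2 (Set.mem_iInter.1 hx (n + 1))
    apply h1.2
    rw [mem_cp]
    refine ⟨p, hp, ?_⟩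
    rw [key n]; simp

def StrongW (P F : Set E2) (W : Win) : Prop :=
  Good P W ∧ ∀ c' : E2 × ℝ, 0 < c'.2 → c'.2 < W.1.2 → ¬ ((F ∩ W.2) \ copySet P c').Countable

open Classical in
noncomputable def badτ (P F : Set E2) (W : Win) : E2 × ℝ :=
  if h : ∃ c' : E2 × ℝ, 0 < c'.2 ∧ c'.2 < W.1.2 ∧ ((F ∩ W.2) \ copySet P c').Countable then
    h.choose else (0, W.1.2 / 2)

theorem badτ_legal (P F : Set E2) (W : Win) (hW : 0 < W.1.2) :
    0 < (badτ P F W).2 ∧ (badτ P F W).2 < W.1.2 := by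
  unfold badτ
  split_ifs with h
  · exact ⟨h.choose_spec.1, h.choose_spec.2.1⟩
  · constructor <;> simp only <;> linarith

theorem badτ_countable {P F : Set E2} {W : Win} (hg : Good P W) (h : ¬ StrongW P F W) :
    ((F ∩ W.2) \ copySet P (badτ P F W)).Countable := by
  have h : ∃ c' : E2 × ℝ, 0 < c'.2 ∧ c'.2 < W.1.2 ∧ ((F ∩ W.2) \ copySet P c').Countable := by
    by_contra hc
    apply h
    refine ⟨hg, fun c' h1 h2 h3 => hc ⟨c', h1, h2, h3⟩⟩
  unfold badτ
  rw [dif_pos h]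
  exact h.choose_spec.2.2

theorem exists_strong_of_cover {P F : Set E2} {S : Set Win} (hS : S.Countable) {Y : Set E2}
    (hg : ∀ W ∈ S, Good P W)
    (hc : {x | x ∈ Y ∧ ∀ W ∈ S, ¬ (x ∈ W.2 ∧ x ∉ copySet P (badτ P F W))}.Countable)
    (hF : ¬ (F ∩ Y).Countable) : ∃ W ∈ S, StrongW P F W := by
  by_contra hn
  push Not at hn
  apply hF
  have h2 : (⋃ W ∈ S, (F ∩ W.2) \ copySet P (badτ P F W)).Countable :=
    hS.biUnion fun W hW => badτ_countable (hg W hW) (hn W hW)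
  refine (hc.union h2).mono ?_
  rintro x ⟨hxF, hxY⟩
  by_cases h : ∀ W ∈ S, ¬ (x ∈ W.2 ∧ x ∉ copySet P (badτ P F W))
  · exact Or.inl ⟨hxY, h⟩
  · push Not at h
    obtain ⟨W, hW, h3, h4⟩ := h
    exact Or.inr (Set.mem_biUnion hW ⟨⟨hxF, h3⟩, h4⟩)

theorem strong_init {P F : Set E2} (hP : IsCompact P) (hconv : Convex ℝ P)
    (hPi : (interior P).Nonempty) (hF : ¬ F.Countable) : ∃ W, StrongW P F W := by
  obtain ⟨S, h1, h2, h3⟩ := open_cover hP hconv hPi isOpen_univ (badτ P F) (badτ_legal P F)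
  obtain ⟨W, -, hW⟩ := exists_strong_of_cover h1 (fun W hW => (h2 W hW).1) h3 (by simpa using hF)
  exact ⟨W, hW⟩

theorem strong_next {P F : Set E2} (hP : IsCompact P) (hconv : Convex ℝ P)
    (hPi : (interior P).Nonempty) {W : Win} (hW : StrongW P F W) (c : E2 × ℝ)
    (hc : 0 < c.2) (hc' : c.2 < W.1.2) :
    ∃ W', StrongW P F W' ∧ copySet P W'.1 ⊆ copySet P W.1 \ copySet P c := by
  obtain ⟨S, h1, h2, h3⟩ := step_cover hP hconv hPi hW.1 c (badτ P F) (badτ_legal P F)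
  obtain ⟨W', hW', h⟩ := exists_strong_of_cover (Y := {x | x ∈ W.2 ∧ x ∉ copySet P c}) h1
    (fun W hW => (h2 W hW).1) h3 (by
      have := hW.2 c hc hc'
      intro h
      apply this
      refine h.mono ?_
      rintro x ⟨⟨ha, hb⟩, hd⟩
      exact ⟨ha, hb, hd⟩)
  exact ⟨W', h, (h2 W' hW').2⟩

open Classical in
noncomputable def nextW (P F : Set E2) (W : Win) (c : E2 × ℝ) : Win :=
  if h : ∃ W', StrongW P F W' ∧ copySet P W'.1 ⊆ copySet P W.1 \ copySet P c then
    h.choose else W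

noncomputable def Wseq (P F : Set E2) (W0 : Win) (m : ℕ → E2 × ℝ) : ℕ → Win
  | 0 => W0
  | n + 1 => nextW P F (Wseq P F W0 m n) (m (2 * n + 1))

theorem Wseq_congr (P F : Set E2) (W0 : Win) (m m' : ℕ → E2 × ℝ) (n : ℕ)
    (h : ∀ i < 2 * n, m i = m' i) : Wseq P F W0 m n = Wseq P F W0 m' n := by
  induction n with
  | zero => rfl
  | succ n ih =>
    simp only [Wseq]
    rw [ih fun i hi => h i (by omega), h (2 * n + 1) (by omega)]

theorem cantor_not_countable : ¬ (Set.univ : Set (ℕ → Bool)).Countable := by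
  intro h2
  have h4 : Cardinal.mk (ℕ → Bool) = Cardinal.continuum := by simp
  have h3 : Countable (ℕ → Bool) := Set.countable_univ_iff.1 h2
  have := Cardinal.mk_le_aleph0 (α := ℕ → Bool)
  rw [h4] at this
  exact absurd this (not_le.2 Cardinal.aleph0_lt_continuum)

theorem perfect_not_countable {F : Set E2} (hF : Perfect F) (hn : F.Nonempty) : ¬ F.Countable := by
  intro hc
  obtain ⟨f, hf, -, hinj⟩ := hF.exists_nat_bool_injection hn
  have h1 : (Set.range f).Countable := hc.mono hf
  rw [← Set.image_univ] at h1
  have h2 := Set.countable_of_injective_of_countable_image hinj.injOn h1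
  exact cantor_not_countable h2

theorem perfect_I {P A : Set E2} (hP : IsCompact P) (hconv : Convex ℝ P)
    (hPi : (interior P).Nonempty) (hA : ContainsPerfectSet A) :
    ∃ σ, WinningI P A σ := by
  obtain ⟨F, hFA, hF, hFn⟩ := hA
  obtain ⟨W0, hW0⟩ := strong_init hP hconv hPi (perfect_not_countable hF hFn)
  refine ⟨fun l => (Wseq P F W0 (fun i => l.getD i 0) (l.length / 2)).1, ?_⟩
  intro m hm
  have key : ∀ n, m (2 * n) = (Wseq P F W0 m n).1 := by
    intro n
    rw [hm n]
    simp only [List.length_ofFn]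
    rw [show 2 * n / 2 = n by omega]
    congr 1
    apply Wseq_congr
    intro i hi
    exact getD_ofFn' m hi 0
  have nx : ∀ n, StrongW P F (Wseq P F W0 m n) → Rule P m (2 * n + 1) →
      StrongW P F (Wseq P F W0 m (n+1)) ∧ copySet P (Wseq P F W0 m (n+1)).1 ⊆
        copySet P (m (2 * n)) \ copySet P (m (2 * n + 1)) := by
    intro n hs hr
    rw [rule_odd, key n] at hr
    have h := strong_next hP hconv hPi hs (m (2 * n + 1)) hr.1 hr.2
    rw [key n]
    simp only [Wseq, nextW]
    rw [dif_pos h]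
    exact h.choose_spec
  have st : ∀ n, (∀ k < 2 * n, Rule P m k) → StrongW P F (Wseq P F W0 m n) := by
    intro n
    induction n with
    | zero => intro _; exact hW0
    | succ n ih =>
      intro h
      exact (nx n (ih fun k hk => h k (by omega)) (h _ (by omega))).1
  refine ⟨?_, ?_⟩
  · intro n hn
    have hs := st n hn
    cases n with
    | zero =>
      rw [Nat.mul_zero, rule_zero]
      have := key 0
      rw [Nat.mul_zero] at this
      rw [this]
      exact hs.1.1
    | succ n =>
      rw [rule_even]
      refine ⟨by rw [key]; exact hs.1.1, ?_⟩
      rw [key (n+1)]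
      exact (nx n (st n fun k hk => hn k (by omega)) (hn _ (by omega))).2
  · intro hr
    have h := IsCompact.nonempty_iInter_of_sequence_nonempty_isCompact_isClosed
      (fun n => copySet P (m (2 * n)) ∩ F) ?_ ?_ ?_ ?_
    · obtain ⟨x, hx⟩ := h
      rw [Set.mem_iInter] at hx
      exact ⟨x, Set.mem_iInter.2 fun n => (hx n).1, hFA (hx 0).2⟩
    · intro n
      exact Set.inter_subset_inter_left _ ((rule_even.1 (hr (2 * (n+1)))).2.trans sdiff_subset)
    · intro n
      have hs := st n fun k _ => hr k
      have h0 := hs.2 (0, (Wseq P F W0 m n).1.2 / 2) (half_pos hs.1.1) (half_lt_self hs.1.1)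
      have : ((F ∩ (Wseq P F W0 m n).2) \ copySet P (0, (Wseq P F W0 m n).1.2 / 2)).Nonempty := by
        by_contra he
        rw [Set.not_nonempty_iff_eq_empty] at he
        rw [he] at h0
        exact h0 Set.countable_empty
      obtain ⟨x, ⟨h1, h2⟩, -⟩ := this
      refine ⟨x, ?_, h1⟩
      rw [key n]
      exact hs.1.2.1 h2
    · exact (isCompact_copy hP _).inter_right hF.closed
    · intro n
      exact (isClosed_copy hP _).inter hF.closed


theorem ofFn_snoc (m : ℕ → E2 × ℝ) (n : ℕ) :
    (List.ofFn fun i : Fin (n + 1) => m i) = (List.ofFn fun i : Fin n => m i) ++ [m n] := by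
  rw [List.ofFn_succ_last]
  simp

noncomputable def posII (σ : Strategy E2) : List Win → List (E2 × ℝ)
  | [] => []
  | W :: h => (posII σ h ++ [W.1]) ++ [σ (posII σ h ++ [W.1])]

noncomputable def resp (σ : Strategy E2) (W : Win) (h : List Win) : E2 × ℝ :=
  σ (posII σ h ++ [W.1])

noncomputable def runII (σ : Strategy E2) (g : ℕ → Win) (k : ℕ) : E2 × ℝ :=
  if k % 2 = 0 then (g (k / 2)).1 else resp σ (g (k / 2)) (PiNat.res g (k / 2))

theorem runII_even (σ : Strategy E2) (g : ℕ → Win) (n : ℕ) : runII σ g (2 * n) = (g n).1 := by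
  unfold runII
  rw [if_pos (by omega), show 2 * n / 2 = n by omega]

theorem runII_odd (σ : Strategy E2) (g : ℕ → Win) (n : ℕ) :
    runII σ g (2 * n + 1) = resp σ (g n) (PiNat.res g n) := by
  unfold runII
  rw [if_neg (by omega), show (2 * n + 1) / 2 = n by omega]

theorem ofFn_runII (σ : Strategy E2) (g : ℕ → Win) (n : ℕ) :
    (List.ofFn fun i : Fin (2 * n) => runII σ g i) = posII σ (PiNat.res g n) := by
  induction n with
  | zero => rfl
  | succ n ih =>
    rw [PiNat.res_succ]
    change (List.ofFn fun i : Fin (2 * n + 1 + 1) => runII σ g i) = _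
    rw [ofFn_snoc, ofFn_snoc, ih, runII_even, runII_odd]
    rfl

theorem runII_follows (σ : Strategy E2) (g : ℕ → Win) : FollowsII σ (runII σ g) := by
  intro n
  rw [ofFn_snoc, ofFn_runII, runII_even, runII_odd]
  rfl

def ValidII (P : Set E2) (σ : Strategy E2) : List Win → Prop
  | [] => True
  | [W] => Good P W
  | W :: V :: h => Good P W ∧ copySet P W.1 ⊆ copySet P V.1 \ copySet P (resp σ V h) ∧
      ValidII P σ (V :: h)

theorem valid_rules {P A : Set E2} {σ : Strategy E2} (hσ : WinningII P A σ) (g : ℕ → Win) (n : ℕ)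
    (hv : ValidII P σ (PiNat.res g n)) : ∀ k < 2 * n, Rule P (runII σ g) k := by
  induction n with
  | zero => intro k hk; omega
  | succ n ih =>
    have hw := (hσ _ (runII_follows σ g)).1 n
    have hmain : (∀ k < 2 * n, Rule P (runII σ g) k) ∧ Rule P (runII σ g) (2 * n) := by
      cases n with
      | zero =>
        refine ⟨fun k hk => by omega, ?_⟩
        rw [Nat.mul_zero, rule_zero]
        have := runII_even σ g 0
        rw [Nat.mul_zero] at this
        rw [this]
        have h : Good P (g 0) := hv
        exact h.1
      | succ n =>
        have h : Good P (g (n+1)) ∧ copySet P (g (n+1)).1 ⊆ copySet P (g n).1 \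
          copySet P (resp σ (g n) (PiNat.res g n)) ∧ ValidII P σ (PiNat.res g (n+1)) := hv
        refine ⟨ih h.2.2, ?_⟩
        rw [rule_even, runII_even, runII_even, runII_odd]
        exact ⟨h.1.1, h.2.1⟩
    have hall : ∀ k < 2 * n + 1, Rule P (runII σ g) k := by
      intro k hk
      rcases Nat.lt_or_ge k (2 * n) with h | h
      · exact hmain.1 k h
      · obtain rfl : k = 2 * n := by omega
        exact hmain.2
    intro k hk
    rcases Nat.lt_or_ge k (2 * n + 1) with h | h
    · exact hall k h
    · obtain rfl : k = 2 * n + 1 := by omega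
      exact hw hall

theorem exists_res {α : Type*} [Nonempty α] (h : List α) : ∃ g : ℕ → α, PiNat.res g h.length = h := by
  induction h with
  | nil => exact ⟨fun _ => Classical.arbitrary α, rfl⟩
  | cons W h ih =>
    obtain ⟨g, hg⟩ := ih
    refine ⟨Function.update g h.length W, ?_⟩
    rw [List.length_cons, PiNat.res_succ, Function.update_self]
    congr 1
    rw [← hg]
    have : (PiNat.res g h.length).length = h.length := by rw [hg]
    rw [this, PiNat.res_eq_res]
    intro m hm
    rw [Function.update_of_ne hm.ne]

theorem resp_legal {P A : Set E2} {σ : Strategy E2} (hσ : WinningII P A σ) {W : Win}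
    {h : List Win} (hv : ValidII P σ (W :: h)) :
    0 < (resp σ W h).2 ∧ (resp σ W h).2 < W.1.2 := by
  obtain ⟨g, hg⟩ := exists_res (W :: h)
  have h1 := valid_rules hσ g (W :: h).length (by rw [hg]; exact hv)
  rw [List.length_cons, PiNat.res_succ] at hg
  rw [List.length_cons] at h1
  have h2 := h1 (2 * h.length + 1) (by omega)
  rw [rule_odd, runII_odd, runII_even] at h2
  injection hg with e1 e2
  rw [e1, e2] at h2
  exact h2

def aliveII (P : Set E2) (σ : Strategy E2) : List Win → Set E2
  | [] => Set.univ
  | W :: h => {x | x ∈ W.2 ∧ x ∉ copySet P (resp σ W h)}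

theorem cov_exists {P A : Set E2} (hP : IsCompact P) (hconv : Convex ℝ P)
    (hPi : (interior P).Nonempty) {σ : Strategy E2} (hσ : WinningII P A σ) (H : List Win)
    (hv : ValidII P σ H) : ∃ S : Set Win, S.Countable ∧ (∀ W ∈ S, ValidII P σ (W :: H)) ∧
      {x | x ∈ aliveII P σ H ∧ ∀ W ∈ S, x ∉ aliveII P σ (W :: H)}.Countable := by
  classical
  set τ : Win → E2 × ℝ := fun W => if 0 < (resp σ W H).2 ∧ (resp σ W H).2 < W.1.2 then
    resp σ W H else (0, W.1.2 / 2) with hτdef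
  have hτ : ∀ W : Win, 0 < W.1.2 → 0 < (τ W).2 ∧ (τ W).2 < W.1.2 := by
    intro W hW
    simp only [hτdef]
    split_ifs with h
    · exact h
    · exact ⟨half_pos hW, half_lt_self hW⟩
  have hval : ∀ W, ValidII P σ (W :: H) → τ W = resp σ W H := by
    intro W hW
    simp only [hτdef]
    rw [if_pos (resp_legal hσ hW)]
  have main : ∃ S : Set Win, S.Countable ∧ (∀ W ∈ S, ValidII P σ (W :: H)) ∧
      {x | x ∈ aliveII P σ H ∧ ∀ W ∈ S, ¬ (x ∈ W.2 ∧ x ∉ copySet P (τ W))}.Countable := by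
    cases H with
    | nil =>
      obtain ⟨S, h1, h2, h3⟩ := open_cover hP hconv hPi isOpen_univ τ hτ
      exact ⟨S, h1, fun W hW => (h2 W hW).1, h3⟩
    | cons V h =>
      have hG : Good P V := by
        cases h with
        | nil => exact hv
        | cons V' h => exact hv.1
      obtain ⟨S, h1, h2, h3⟩ := step_cover hP hconv hPi hG (resp σ V h) τ hτ
      exact ⟨S, h1, fun W hW => ⟨(h2 W hW).1, (h2 W hW).2, hv⟩, h3⟩
  obtain ⟨S, h1, h2, h3⟩ := main
  refine ⟨S, h1, h2, h3.mono ?_⟩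
  rintro x ⟨hx, hx'⟩
  refine ⟨hx, fun W hW => ?_⟩
  rw [hval W (h2 W hW)]
  exact hx' W hW

def treeII (cov : List Win → Set Win) : ℕ → Set (List Win)
  | 0 => {[]}
  | n + 1 => ⋃ H ∈ treeII cov n, (fun W => W :: H) '' cov H

theorem II_countable {P A : Set E2} (hP : IsCompact P) (hconv : Convex ℝ P)
    (hPi : (interior P).Nonempty) {σ : Strategy E2} (hσ : WinningII P A σ) : A.Countable := by
  have hc := cov_exists hP hconv hPi hσ
  choose! cov h1 h2 h3 using hc
  have hT : ∀ n, ∀ H ∈ treeII cov n, ValidII P σ H := by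
    intro n
    induction n with
    | zero => intro H hH; rw [show H = [] from hH]; exact trivial
    | succ n ih =>
      intro H hH
      simp only [treeII, Set.mem_iUnion] at hH
      obtain ⟨H', hH', W, hW, rfl⟩ := hH
      exact h2 H' (ih H' hH') W hW
  have hTc : ∀ n, (treeII cov n).Countable := by
    intro n
    induction n with
    | zero => exact Set.countable_singleton _
    | succ n ih => exact ih.biUnion fun H hH => (h1 H (hT n H hH)).image _
  have hZ : (⋃ n, ⋃ H ∈ treeII cov n,
      {x | x ∈ aliveII P σ H ∧ ∀ W ∈ cov H, x ∉ aliveII P σ (W :: H)}).Countable :=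
    Set.countable_iUnion fun n => (hTc n).biUnion fun H hH => h3 H (hT n H hH)
  refine hZ.mono ?_
  intro x hxA
  by_contra hxZ
  simp only [Set.mem_iUnion, not_exists] at hxZ
  have step : ∀ H, (x ∈ aliveII P σ H ∧ ∃ n, H ∈ treeII cov n) →
      ∃ W, (x ∈ aliveII P σ (W :: H) ∧ ∃ n, (W :: H) ∈ treeII cov n) := by
    rintro H ⟨ha, n, hn⟩
    have := hxZ n H hn
    by_contra hcon
    apply this
    refine ⟨ha, fun W hW hx => hcon ⟨W, hx, n + 1, ?_⟩⟩
    simp only [treeII, Set.mem_iUnion]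
    exact ⟨H, hn, W, hW, rfl⟩
  choose! nx hnx using step
  let Hs : ℕ → List Win := fun n => Nat.rec [] (fun _ H => nx H :: H) n
  let g : ℕ → Win := fun n => nx (Hs n)
  have hres : ∀ n, PiNat.res g n = Hs n := by
    intro n
    induction n with
    | zero => rfl
    | succ n ih => rw [PiNat.res_succ, ih]
  have hQ : ∀ n, x ∈ aliveII P σ (Hs n) ∧ ∃ k, Hs n ∈ treeII cov k := by
    intro n
    induction n with
    | zero => exact ⟨trivial, 0, rfl⟩
    | succ n ih => exact hnx _ ih
  have hV : ∀ n, ValidII P σ (PiNat.res g n) := by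
    intro n
    rw [hres]
    obtain ⟨-, k, hk⟩ := hQ n
    exact hT k _ hk
  have hR : ∀ n, Rule P (runII σ g) n := fun n => valid_rules hσ g (n + 1) (hV _) n (by omega)
  have hfin := (hσ _ (runII_follows σ g)).2 hR
  rw [Set.eq_empty_iff_forall_notMem] at hfin
  refine hfin x ⟨Set.mem_iInter.2 fun n => ?_, hxA⟩
  rw [runII_even]
  have hg : Good P (g n) := by
    have := hV (n + 1)
    rw [PiNat.res_succ] at this
    cases hh : PiNat.res g n with
    | nil => rw [hh] at this; exact this
    | cons V h => rw [hh] at this; exact this.1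
  have hx : x ∈ (g n).2 := ((hQ (n + 1)).1).1
  exact hg.2.1 hx


noncomputable def posI (σ : Strategy E2) : List (E2 × ℝ) → List (E2 × ℝ)
  | [] => []
  | b :: h => (posI σ h ++ [σ (posI σ h)]) ++ [b]

noncomputable def IM (σ : Strategy E2) (h : List (E2 × ℝ)) : E2 × ℝ := σ (posI σ h)

noncomputable def runI (σ : Strategy E2) (g : ℕ → E2 × ℝ) (k : ℕ) : E2 × ℝ :=
  if k % 2 = 0 then IM σ (PiNat.res g (k / 2)) else g (k / 2)

theorem runI_even (σ : Strategy E2) (g : ℕ → E2 × ℝ) (n : ℕ) :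
    runI σ g (2 * n) = IM σ (PiNat.res g n) := by
  unfold runI
  rw [if_pos (by omega), show 2 * n / 2 = n by omega]

theorem runI_odd (σ : Strategy E2) (g : ℕ → E2 × ℝ) (n : ℕ) : runI σ g (2 * n + 1) = g n := by
  unfold runI
  rw [if_neg (by omega), show (2 * n + 1) / 2 = n by omega]

theorem ofFn_runI (σ : Strategy E2) (g : ℕ → E2 × ℝ) (n : ℕ) :
    (List.ofFn fun i : Fin (2 * n) => runI σ g i) = posI σ (PiNat.res g n) := by
  induction n with
  | zero => rfl
  | succ n ih =>
    rw [PiNat.res_succ]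
    change (List.ofFn fun i : Fin (2 * n + 1 + 1) => runI σ g i) = _
    rw [ofFn_snoc, ofFn_snoc, ih, runI_even, runI_odd]
    rfl

theorem runI_follows (σ : Strategy E2) (g : ℕ → E2 × ℝ) : FollowsI σ (runI σ g) := by
  intro n
  rw [ofFn_runI, runI_even]
  rfl

def LegI (σ : Strategy E2) : List (E2 × ℝ) → Prop
  | [] => True
  | b :: h => LegI σ h ∧ 0 < b.2 ∧ b.2 < (IM σ h).2

theorem legI_rules {P A : Set E2} {σ : Strategy E2} (hσ : WinningI P A σ) (g : ℕ → E2 × ℝ) (n : ℕ)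
    (hv : LegI σ (PiNat.res g n)) : ∀ k < 2 * n + 1, Rule P (runI σ g) k := by
  have hw := (hσ _ (runI_follows σ g)).1
  induction n with
  | zero =>
    intro k hk
    obtain rfl : k = 2 * 0 := by omega
    exact hw 0 fun k hk => by omega
  | succ n ih =>
    have h : LegI σ (PiNat.res g n) ∧ 0 < (g n).2 ∧ (g n).2 < (IM σ (PiNat.res g n)).2 := hv
    have h1 := ih h.1
    have h2 : ∀ k < 2 * (n + 1), Rule P (runI σ g) k := by
      intro k hk
      rcases Nat.lt_or_ge k (2 * n + 1) with h' | h'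
      · exact h1 k h'
      · obtain rfl : k = 2 * n + 1 := by omega
        rw [rule_odd, runI_even, runI_odd]
        exact h.2
    intro k hk
    rcases Nat.lt_or_ge k (2 * (n + 1)) with h' | h'
    · exact h2 k h'
    · obtain rfl : k = 2 * (n + 1) := by omega
      exact hw _ h2

theorem IM_pos {P A : Set E2} {σ : Strategy E2} (hσ : WinningI P A σ) {h : List (E2 × ℝ)}
    (hv : LegI σ h) : 0 < (IM σ h).2 := by
  obtain ⟨g, hg⟩ := exists_res h
  have h1 := (legI_rules hσ g h.length (by rw [hg]; exact hv) (2 * h.length) (by omega)).1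
  rwa [runI_even, hg] at h1

theorem IM_sub {P A : Set E2} {σ : Strategy E2} (hσ : WinningI P A σ) {b : E2 × ℝ}
    {h : List (E2 × ℝ)} (hv : LegI σ (b :: h)) :
    copySet P (IM σ (b :: h)) ⊆ copySet P (IM σ h) \ copySet P b := by
  obtain ⟨g, hg⟩ := exists_res (b :: h)
  have h1 := legI_rules hσ g (b :: h).length (by rw [hg]; exact hv) (2 * (h.length + 1))
    (by rw [List.length_cons]; omega)
  have hg' := hg
  rw [List.length_cons] at hg
  rw [List.length_cons, PiNat.res_succ] at hg'
  rw [rule_even, runI_even, runI_even, runI_odd, hg] at h1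
  injection hg' with e1 e2
  rw [e1, e2] at h1
  exact h1.2

theorem shrink_exists {P : Set E2} (hP : IsCompact P) (hPi : (interior P).Nonempty) :
    ∃ s : E2 × ℝ → E2 × ℝ, ∀ c, 0 < c.2 → 0 < (s c).2 ∧ (s c).2 < c.2 ∧
      ∀ c' : E2 × ℝ, 0 < c'.2 → copySet P c' ⊆ copySet P c \ copySet P (s c) → c'.2 ≤ c.2 / 2 := by
  obtain ⟨z0, hz0⟩ := hPi
  obtain ⟨δ, hδ, hball⟩ := Metric.nhds_basis_closedBall.mem_iff.1 (mem_interior_iff_mem_nhds.1 hz0)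
  obtain ⟨B, hB⟩ := hP.isBounded.exists_norm_le
  have hB0 : 0 ≤ B := (norm_nonneg z0).trans (hB z0 (interior_subset hz0))
  set ε := min (1 / 2) (δ / (4 * B + 1)) with hε
  have hε0 : 0 < ε := by positivity
  have hε1 : ε ≤ 1 / 2 := min_le_left _ _
  have hε2 : ε * (4 * B) ≤ δ := by
    have h1 : ε ≤ δ / (4 * B + 1) := min_le_right _ _
    rw [le_div_iff₀ (by positivity)] at h1
    nlinarith
  refine ⟨fun c => (c.1 + (ε * c.2) • z0, (1 - ε) * c.2), fun c hc => ⟨?_, ?_, ?_⟩⟩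
  · simp only; nlinarith
  · simp only; nlinarith
  · intro c' hc' hsub
    by_contra hlt
    push Not at hlt
    have hy : c'.1 + c'.2 • z0 ∈ copySet P c' := mem_cp.2 ⟨z0, interior_subset hz0, rfl⟩
    obtain ⟨p, hp, hyp⟩ := mem_cp.1 (hsub hy).1
    have hw : c'.1 + c'.2 • (z0 + (ε * c.2 / c'.2) • (z0 - p)) ∈ copySet P c' := by
      refine mem_cp.2 ⟨_, hball ?_, rfl⟩
      rw [Metric.mem_closedBall, dist_eq_norm, add_sub_cancel_left, norm_smul,
        Real.norm_of_nonneg (by positivity)]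
      have h1 : ‖z0 - p‖ ≤ 2 * B := by
        have := norm_sub_le z0 p
        have := hB z0 (interior_subset hz0)
        have := hB p hp
        linarith
      have h2 : ε * c.2 / c'.2 ≤ 2 * ε := by
        rw [div_le_iff₀ hc']; nlinarith
      calc ε * c.2 / c'.2 * ‖z0 - p‖ ≤ (2 * ε) * (2 * B) := by gcongr
        _ ≤ δ := by linarith
    refine (hsub hw).2 (mem_cp.2 ⟨p, hp, ?_⟩)
    have e : c'.2 * (ε * c.2 / c'.2) = ε * c.2 := by field_simp
    simp only
    rw [smul_add, smul_smul, e, ← add_assoc, hyp]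
    module

theorem radius_mono {P : Set E2} (hP : IsCompact P) (hPi : (interior P).Nonempty)
    {c c' : E2 × ℝ} (hc : 0 < c.2) (hc' : 0 < c'.2) (h : copySet P c' ⊆ copySet P c) :
    c'.2 ≤ c.2 := by
  have hPn : P.Nonempty := hPi.mono interior_subset
  obtain ⟨⟨p, q⟩, ⟨hp, hq⟩, hmax⟩ := (hP.prod hP).exists_isMaxOn (hPn.prod hPn)
    (f := fun z : E2 × E2 => dist z.1 z.2) (by fun_prop)
  simp only at hp hq
  have hm : ∀ a ∈ P, ∀ b ∈ P, dist a b ≤ dist p q := fun a ha b hb =>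
    (isMaxOn_iff.1 hmax) (a, b) (Set.mk_mem_prod ha hb)
  clear hmax
  have hd : 0 < dist p q := by
    by_contra hd
    have hs : P.Subsingleton := by
      intro a ha b hb
      have h1 : dist a b ≤ dist p q := hm a ha b hb
      exact dist_le_zero.1 (by linarith)
    obtain ⟨z, hz⟩ := hPi
    have h2 : P ⊆ {z} := fun a ha => hs ha (interior_subset hz)
    have h3 := interior_mono h2 hz
    rw [interior_singleton] at h3
    exact h3
  obtain ⟨p', hp', e1⟩ := mem_cp.1 (h (mem_cp.2 ⟨p, hp, rfl⟩))
  obtain ⟨q', hq', e2⟩ := mem_cp.1 (h (mem_cp.2 ⟨q, hq, rfl⟩))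
  have h1 : dist p' q' ≤ dist p q := hm p' hp' q' hq'
  have h2 : c'.2 * dist p q = c.2 * dist p' q' := by
    have := congrArg₂ dist e1 e2
    simpa [dist_smul₀, abs_of_pos hc, abs_of_pos hc'] using this
  have h3 : c'.2 * dist p q ≤ c.2 * dist p q := by rw [h2]; gcongr
  exact le_of_mul_le_mul_right h3 hd

noncomputable def sndI (σ : Strategy E2) (s : E2 × ℝ → E2 × ℝ) (t : Bool) (h : List (E2 × ℝ)) :
    E2 × ℝ :=
  if t then IM σ (s (IM σ h) :: h) else s (IM σ h)

noncomputable def HI (σ : Strategy E2) (s : E2 × ℝ → E2 × ℝ) : List Bool → List (E2 × ℝ)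
  | [] => []
  | t :: l => sndI σ s t (s (IM σ (HI σ s l)) :: HI σ s l) :: s (IM σ (HI σ s l)) :: HI σ s l

noncomputable def bI (σ : Strategy E2) (s : E2 × ℝ → E2 × ℝ) (x : ℕ → Bool) (k : ℕ) : E2 × ℝ :=
  if k % 2 = 0 then s (IM σ (HI σ s (PiNat.res x (k / 2)))) else
    sndI σ s (x (k / 2)) (s (IM σ (HI σ s (PiNat.res x (k / 2)))) :: HI σ s (PiNat.res x (k / 2)))

theorem res_bI (σ : Strategy E2) (s : E2 × ℝ → E2 × ℝ) (x : ℕ → Bool) (n : ℕ) :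
    PiNat.res (bI σ s x) (2 * n) = HI σ s (PiNat.res x n) := by
  induction n with
  | zero => rfl
  | succ n ih =>
    change PiNat.res (bI σ s x) (2 * n + 1 + 1) = _
    rw [PiNat.res_succ, PiNat.res_succ, PiNat.res_succ, ih]
    have e1 : bI σ s x (2 * n) = s (IM σ (HI σ s (PiNat.res x n))) := by
      unfold bI
      rw [if_pos (by omega), show 2 * n / 2 = n by omega]
    have e2 : bI σ s x (2 * n + 1) =
        sndI σ s (x n) (s (IM σ (HI σ s (PiNat.res x n))) :: HI σ s (PiNat.res x n)) := by
      unfold bI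
      rw [if_neg (by omega), show (2 * n + 1) / 2 = n by omega]
    rw [e1, e2]
    rfl

theorem I_perfect {P A : Set E2} (hP : IsCompact P)
    (hPi : (interior P).Nonempty) {σ : Strategy E2} (hσ : WinningI P A σ) :
    ContainsPerfectSet A := by
  obtain ⟨s, hs⟩ := shrink_exists hP hPi
  have L1 : ∀ h, LegI σ h → LegI σ (s (IM σ h) :: h) ∧
      (IM σ (s (IM σ h) :: h)).2 ≤ (IM σ h).2 / 2 := by
    intro h hl
    have hp := IM_pos hσ hl
    have hl' : LegI σ (s (IM σ h) :: h) := ⟨hl, (hs _ hp).1, (hs _ hp).2.1⟩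
    exact ⟨hl', (hs _ hp).2.2 _ (IM_pos hσ hl') (IM_sub hσ hl')⟩
  have L2 : ∀ t h, LegI σ h → LegI σ (sndI σ s t h :: h) ∧
      (IM σ (sndI σ s t h :: h)).2 ≤ (IM σ h).2 := by
    intro t h hl
    have hp := IM_pos hσ hl
    have hl1 := L1 h hl
    have hp1 := IM_pos hσ hl1.1
    have hl2 : LegI σ (sndI σ s t h :: h) := by
      cases t with
      | false => exact hl1.1
      | true =>
        refine ⟨hl, hp1, ?_⟩
        change (IM σ (s (IM σ h) :: h)).2 < _
        linarith [hl1.2]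
    exact ⟨hl2, radius_mono hP hPi hp (IM_pos hσ hl2) ((IM_sub hσ hl2).trans sdiff_subset)⟩
  have LH : ∀ l, LegI σ (HI σ s l) := by
    intro l
    induction l with
    | nil => trivial
    | cons t l ih => exact (L2 t _ (L1 _ ih).1).1
  have rad : ∀ t l, (IM σ (HI σ s (t :: l))).2 ≤ (IM σ (HI σ s l)).2 / 2 := fun t l =>
    (L2 t _ (L1 _ (LH l)).1).2.trans (L1 _ (LH l)).2
  have rad2 : ∀ (x : ℕ → Bool) n, (IM σ (HI σ s (PiNat.res x n))).2 ≤ (IM σ []).2 * (1 / 2) ^ n := by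
    intro x n
    induction n with
    | zero => simp [HI]
    | succ n ih =>
      have := rad (x n) (PiNat.res x n)
      rw [PiNat.res_succ, pow_succ]
      linarith
  have disj : ∀ l, ∀ y ∈ copySet P (IM σ (HI σ s (false :: l))),
      y ∉ copySet P (IM σ (HI σ s (true :: l))) := by
    intro l y hy hy'
    have h2 := (L2 true _ (L1 _ (LH l)).1).1
    exact (IM_sub hσ h2 hy').2 hy
  have ex : ∀ x : ℕ → Bool, ∃ y ∈ A, ∀ n, y ∈ copySet P (IM σ (HI σ s (PiNat.res x n))) := by
    intro x
    have hR : ∀ n, Rule P (runI σ (bI σ s x)) n := fun n =>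
      legI_rules hσ (bI σ s x) (2 * n) (by rw [res_bI]; exact LH _) n (by omega)
    obtain ⟨y, hy, hyA⟩ := (hσ _ (runI_follows σ (bI σ s x))).2 hR
    refine ⟨y, hyA, fun n => ?_⟩
    have := Set.mem_iInter.1 hy (2 * n)
    rwa [runI_even, res_bI] at this
  choose f hfA hf using ex
  have hinj : Function.Injective f := by
    intro x y hxy
    apply PiNat.res_injective
    funext n
    induction n with
    | zero => rfl
    | succ n ih =>
      have h1 := hf x (n + 1)
      have h2 := hf y (n + 1)
      rw [PiNat.res_succ] at h1 h2
      rw [hxy, ih] at h1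
      rw [PiNat.res_succ, PiNat.res_succ, ih]
      congr 1
      cases hx : x n <;> cases hy : y n <;> rw [hx] at h1 <;> rw [hy] at h2
      · exact absurd h2 (disj _ _ h1)
      · exact absurd h1 (disj _ _ h2)
  obtain ⟨D, hD⟩ := Metric.isBounded_iff.1 hP.isBounded
  have hcont : Continuous f := by
    rw [continuous_iff_continuousAt]
    intro x
    rw [ContinuousAt, Metric.tendsto_nhds]
    intro ε hε
    have hlim : Tendsto (fun n : ℕ => ((IM σ []).2 * (1 / 2 : ℝ) ^ n) * |D|) atTop (𝓝 0) := by
      have := ((tendsto_pow_atTop_nhds_zero_of_lt_one (r := (1 / 2 : ℝ)) (by norm_num)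
        (by norm_num)).const_mul (IM σ []).2).mul_const |D|
      simpa using this
    obtain ⟨n, hn⟩ := (hlim.eventually (gt_mem_nhds hε)).exists
    have ho := (PiNat.isOpen_cylinder (fun _ => Bool) x n).mem_nhds (PiNat.self_mem_cylinder x n)
    filter_upwards [ho] with y hy
    rw [PiNat.cylinder_eq_res] at hy
    have hy : PiNat.res y n = PiNat.res x n := hy
    have h1 := hf x n
    have h2 := hf y n
    rw [hy] at h2
    have hp := IM_pos hσ (LH (PiNat.res x n))
    have hr := rad2 x n
    obtain ⟨p, hp', e1⟩ := mem_cp.1 h1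
    obtain ⟨q, hq', e2⟩ := mem_cp.1 h2
    have hd : dist q p ≤ |D| := (hD hq' hp').trans (le_abs_self D)
    rw [e1, e2, dist_add_left, dist_smul₀, Real.norm_of_nonneg hp.le]
    refine lt_of_le_of_lt ?_ hn
    have h0 := hp.le.trans hr
    gcongr
  have hcl : IsClosed (Set.range f) := (isCompact_range hcont).isClosed
  have hunc : ¬ (Set.range f).Countable := by
    intro h
    rw [← Set.image_univ] at h
    exact cantor_not_countable (Set.countable_of_injective_of_countable_image hinj.injOn h)
  obtain ⟨F, h1, h2, h3⟩ := exists_perfect_nonempty_of_isClosed_of_not_countable hcl hunc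
  refine ⟨F, h3.trans ?_, h1, h2⟩
  rintro _ ⟨x, rfl⟩
  exact hfA x


/-- **Theorem (planar case).** Let `P ⊆ ℝ²` be a compact convex set with nonempty interior.
Then for every target set `A ⊆ ℝ²` the no-β McMullen game `G_P(A)` is equivalent to the
perfect set game: player I has a winning strategy iff `A` contains a perfect set, and player
II has a winning strategy iff `A` is countable. -/
theorem noBeta_mcMullen_plane (P : Set (EuclideanSpace ℝ (Fin 2)))
    (hPcomp : IsCompact P) (hPconv : Convex ℝ P) (hPint : (interior P).Nonempty)
    (A : Set (EuclideanSpace ℝ (Fin 2))) :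
    ((∃ σ, WinningI P A σ) ↔ ContainsPerfectSet A) ∧
    ((∃ σ, WinningII P A σ) ↔ A.Countable) := by
  refine ⟨⟨?_, ?_⟩, ⟨?_, ?_⟩⟩
  · rintro ⟨σ, hσ⟩
    exact I_perfect hPcomp hPint hσ
  · exact perfect_I hPcomp hPconv hPint
  · rintro ⟨σ, hσ⟩
    exact II_countable hPcomp hPconv hPint hσ
  · exact countable_II (hPint.mono interior_subset)
end

section
/- Let X be a real Banach space, let P ⊆ X be a bounded, closed, convex set, and let A ⊆ X. If player I has a winning strategy in the no-β McMullen game G_P(A), then A contains a perfect set. -/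
open Pointwise Filter Topology Set

theorem mem_copySet' {X : Type*} [AddCommGroup X] [Module ℝ X] (P : Set X) (c : X × ℝ) (a : X) :
    a ∈ copySet P c ↔ ∃ p ∈ P, a = c.1 + c.2 • p := by
  unfold copySet
  rw [Set.mem_vadd_set]
  constructor
  · rintro ⟨b, hb, rfl⟩
    obtain ⟨p, hp, rfl⟩ := Set.mem_smul_set.1 hb
    exact ⟨p, hp, rfl⟩
  · rintro ⟨p, hp, rfl⟩
    exact ⟨c.2 • p, Set.smul_mem_smul_set hp, rfl⟩

/-- The half-size copy inside `c` homothetic about the point `p` of `P`. -/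
noncomputable def halfMove {X : Type*} [AddCommGroup X] [Module ℝ X] (c : X × ℝ) (p : X) : X × ℝ :=
  (c.1 + (c.2 / 2) • p, c.2 / 2)

/-- The fixed point. -/
noncomputable def fixPt {X : Type*} [AddCommGroup X] [Module ℝ X] (c c' : X × ℝ) : X :=
  (c.2 - c'.2)⁻¹ • (c'.1 - c.1)

theorem fix_mem {X : Type*} [NormedAddCommGroup X] [NormedSpace ℝ X]
    (P : Set X) (hPcl : IsClosed P) (y : X) (r : ℝ) (h0 : 0 < r) (h1 : r < 1)
    (hP : P.Nonempty) (h : ∀ p ∈ P, y + r • p ∈ P) : (1 - r)⁻¹ • y ∈ P := by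
  obtain ⟨p, hp⟩ := hP
  set z := (1 - r)⁻¹ • y with hz
  have hy : y = (1 - r) • z := by
    rw [hz, smul_smul, mul_inv_cancel₀ (by linarith), one_smul]
  have key : ∀ n : ℕ, z + r ^ n • (p - z) ∈ P := by
    intro n
    induction n with
    | zero => simpa using hp
    | succ n ih =>
      have := h _ ih
      rw [hy] at this
      convert this using 1
      rw [pow_succ]
      module
  have ht : Tendsto (fun n : ℕ => z + r ^ n • (p - z)) atTop (𝓝 (z + (0 : ℝ) • (p - z))) :=
    ((tendsto_pow_atTop_nhds_zero_of_lt_one h0.le h1).smul_const _).const_add _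
  simp only [zero_smul, add_zero] at ht
  exact hPcl.mem_of_tendsto ht (Eventually.of_forall key)

/-- normalized key lemma -/
theorem key_norm {X : Type*} [NormedAddCommGroup X] [NormedSpace ℝ X]
    (P : Set X) (hPbd : Bornology.IsBounded P) (hPcl : IsClosed P)
    (hPconv : Convex ℝ P) (y : X) (r : ℝ) (h0 : 0 < r) (p : X) (hp : p ∈ P)
    (h : ∀ q ∈ P, y + r • q ∈ P)
    (hd : ∀ q ∈ P, ∀ q' ∈ P, y + r • q ≠ (1 / 2 : ℝ) • p + (1 / 2 : ℝ) • q') : r < 1 / 2 := by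
  by_contra hr
  push Not at hr
  rcases lt_trichotomy r 1 with h1 | h1 | h1
  · have hz := fix_mem P hPcl y r h0 h1 ⟨p, hp⟩ h
    set z := (1 - r)⁻¹ • y with hz'
    have hy : y = (1 - r) • z := by
      rw [hz', smul_smul, mul_inv_cancel₀ (by linarith), one_smul]
    refine hd p hp ((2 - 2 * r) • z + (2 * r - 1) • p)
      (hPconv hz hp (by linarith) (by linarith) (by ring)) ?_
    rw [hy]
    module
  · subst h1
    have key : ∀ n : ℕ, p + (n : ℝ) • y ∈ P := by
      intro n
      induction n with
      | zero => simpa using hp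
      | succ n ih =>
        have := h _ ih
        convert this using 1
        push_cast
        module
    obtain ⟨C, hC⟩ := hPbd.exists_norm_le
    have hy : y = 0 := by
      by_contra hy
      have hy' : 0 < ‖y‖ := norm_pos_iff.2 hy
      obtain ⟨n, hn⟩ := exists_nat_gt ((2 * C) / ‖y‖)
      rw [div_lt_iff₀ hy'] at hn
      have h1 := hC _ (key n)
      have h2 := hC _ hp
      have h3 : ‖(n : ℝ) • y‖ ≤ ‖p + (n : ℝ) • y‖ + ‖p‖ := by
        have := norm_sub_le (p + (n : ℝ) • y) p
        simpa using this
      rw [norm_smul] at h3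
      simp at h3
      linarith
    refine hd p hp p hp ?_
    rw [hy]
    module
  · have hdiam : ∀ a ∈ P, ∀ b ∈ P, dist a b ≤ Metric.diam P / r := by
      intro a ha b hb
      have := Metric.dist_le_diam_of_mem hPbd (h a ha) (h b hb)
      rw [dist_add_left, dist_smul₀, Real.norm_of_nonneg h0.le] at this
      rw [le_div_iff₀ h0]
      linarith
    have hle := Metric.diam_le_of_forall_dist_le (div_nonneg Metric.diam_nonneg h0.le) hdiam
    have hdz : Metric.diam P = 0 := by
      rw [le_div_iff₀ h0] at hle
      nlinarith [Metric.diam_nonneg (s := P)]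
    have := hdiam (y + r • p) (h p hp) p hp
    rw [hdz, zero_div] at this
    have := dist_le_zero.1 this
    refine hd p hp p hp ?_
    rw [this]
    module

theorem key_copy {X : Type*} [NormedAddCommGroup X] [NormedSpace ℝ X]
    (P : Set X) (hPbd : Bornology.IsBounded P) (hPcl : IsClosed P)
    (hPconv : Convex ℝ P) (c c' : X × ℝ) (hc : 0 < c.2) (hc' : 0 < c'.2) (p : X) (hp : p ∈ P)
    (h : copySet P c' ⊆ copySet P c \ copySet P (halfMove c p)) :
    c'.2 < c.2 / 2 ∧ fixPt c c' ∈ P ∧ copySet P c' ⊆ copySet P (halfMove c (fixPt c c')) := by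
  have hcne := hc.ne'
  set r := c'.2 / c.2 with hr
  set y := c.2⁻¹ • (c'.1 - c.1) with hy
  have hr2 : c'.2 = c.2 * r := by rw [hr]; field_simp
  have hy1 : c'.1 = c.1 + c.2 • y := by
    rw [hy, smul_smul, mul_inv_cancel₀ hcne, one_smul]; abel
  have h0 : 0 < r := by positivity
  have e : ∀ q, c'.1 + c'.2 • q = c.1 + c.2 • (y + r • q) := by
    intro q; rw [hr2, hy1]; module
  have hin : ∀ q ∈ P, y + r • q ∈ P := by
    intro q hq
    have h1 := (h ((mem_copySet' P c' _).2 ⟨q, hq, rfl⟩)).1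
    obtain ⟨q', hq', h2⟩ := (mem_copySet' P c _).1 h1
    rw [e, add_right_inj] at h2
    rwa [smul_right_injective X hcne h2]
  have hlt : r < 1 / 2 := by
    refine key_norm P hPbd hPcl hPconv y r h0 p hp hin ?_
    intro q hq q' hq' heq
    refine (h ((mem_copySet' P c' _).2 ⟨q, hq, rfl⟩)).2 ((mem_copySet' P _ _).2 ⟨q', hq', ?_⟩)
    rw [e, heq]
    simp only [halfMove]
    module
  have hfix : fixPt c c' = (1 - r)⁻¹ • y := by
    have : c.2 - c'.2 = c.2 * (1 - r) := by rw [hr2]; ring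
    rw [fixPt, this, mul_inv, hy, smul_smul, mul_comm]
  have hz : fixPt c c' ∈ P := by
    rw [hfix]
    exact fix_mem P hPcl y r h0 (by linarith) ⟨p, hp⟩ hin
  have hy2 : y = (1 - r) • fixPt c c' := by
    rw [hfix, smul_smul, mul_inv_cancel₀ (by linarith), one_smul]
  refine ⟨by rw [hr2]; nlinarith, hz, ?_⟩
  intro a ha
  obtain ⟨q, hq, rfl⟩ := (mem_copySet' P c' _).1 ha
  refine (mem_copySet' P _ _).2 ⟨(1 - 2 * r) • fixPt c c' + (2 * r) • q,
    hPconv hz hq (by linarith) (by linarith) (by ring), ?_⟩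
  rw [e]
  generalize fixPt c c' = z at hy2
  rw [hy2]
  simp only [halfMove]
  module

/-- Player II's two options. -/
noncomputable def tau {X : Type*} [AddCommGroup X] [Module ℝ X] (σ : Strategy X) (p : X)
    (b : Bool) (L : List (X × ℝ)) : X × ℝ :=
  let c := L.getLastD (0, 0)
  let d := halfMove c p
  if b then halfMove c (fixPt c (σ (L ++ [d]))) else d

/-- One step of the run. -/
noncomputable def stp {X : Type*} [AddCommGroup X] [Module ℝ X] (σ : Strategy X) (p : X)
    (x : ℕ → Bool) (k : ℕ) (L : List (X × ℝ)) : X × ℝ :=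
  if k % 2 = 1 then tau σ p (x (k / 2)) L else σ L

/-- History of the run. -/
noncomputable def hist {X : Type*} [AddCommGroup X] [Module ℝ X] (σ : Strategy X) (p : X)
    (x : ℕ → Bool) : ℕ → List (X × ℝ)
  | 0 => []
  | k + 1 => hist σ p x k ++ [stp σ p x k (hist σ p x k)]

/-- The run. -/
noncomputable def rn {X : Type*} [AddCommGroup X] [Module ℝ X] (σ : Strategy X) (p : X)
    (x : ℕ → Bool) (k : ℕ) : X × ℝ := stp σ p x k (hist σ p x k)

section
variable {X : Type*} [AddCommGroup X] [Module ℝ X] (σ : Strategy X) (p : X)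

theorem hist_succ (x : ℕ → Bool) (k : ℕ) :
    hist σ p x (k + 1) = hist σ p x k ++ [rn σ p x k] := rfl

theorem ofFn_rn (x : ℕ → Bool) (k : ℕ) :
    (List.ofFn fun i : Fin k => rn σ p x i) = hist σ p x k := by
  induction k with
  | zero => rfl
  | succ k ih =>
    rw [List.ofFn_succ', hist_succ, List.concat_eq_append, ← ih]
    rfl

theorem rn_even (x : ℕ → Bool) (n : ℕ) : rn σ p x (2 * n) = σ (hist σ p x (2 * n)) := by
  simp [rn, stp]

theorem rn_odd (x : ℕ → Bool) (n : ℕ) :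
    rn σ p x (2 * n + 1) = tau σ p (x n) (hist σ p x (2 * n + 1)) := by
  have h1 : (2 * n + 1) % 2 = 1 := by omega
  have h2 : (2 * n + 1) / 2 = n := by omega
  simp [rn, stp, h1, h2]

theorem follows_rn (x : ℕ → Bool) : FollowsI σ (rn σ p x) := by
  intro n
  rw [ofFn_rn, rn_even]

theorem last_hist (x : ℕ → Bool) (k : ℕ) :
    (hist σ p x (k + 1)).getLastD (0, 0) = rn σ p x k := by
  rw [hist_succ]
  simp

theorem rn_odd_false (x : ℕ → Bool) (n : ℕ) (hx : x n = false) :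
    rn σ p x (2 * n + 1) = halfMove (rn σ p x (2 * n)) p := by
  rw [rn_odd, hx, tau, last_hist]
  simp

theorem hist_congr (x y : ℕ → Bool) (n : ℕ) (h : ∀ i < n, x i = y i) :
    ∀ k ≤ 2 * n + 1, hist σ p x k = hist σ p y k := by
  intro k
  induction k with
  | zero => intro _; rfl
  | succ k ih =>
    intro hk
    have ih' := ih (by omega)
    have : rn σ p x k = rn σ p y k := by
      unfold rn stp
      rw [ih']
      split_ifs with hk2
      · rw [h (k / 2) (by omega)]
      · rfl
    rw [hist_succ, hist_succ, ih', this]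

theorem rn_congr (x y : ℕ → Bool) (n : ℕ) (h : ∀ i < n, x i = y i) :
    rn σ p x (2 * n) = rn σ p y (2 * n) := by
  rw [rn_even, rn_even, hist_congr σ p x y n h _ (by omega)]

theorem rn_odd_true (x y : ℕ → Bool) (n : ℕ) (h : ∀ i < n, x i = y i) (hx : x n = false)
    (hy : y n = true) :
    rn σ p y (2 * n + 1) =
      halfMove (rn σ p x (2 * n)) (fixPt (rn σ p x (2 * n)) (rn σ p x (2 * (n + 1)))) := by
  rw [rn_odd, hy, tau, last_hist, ← rn_congr σ p x y n h, ← hist_congr σ p x y n h _ le_rfl,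
    rn_even σ p x (n + 1), ← rn_odd_false σ p x n hx, ← hist_succ]
  simp only [if_true]
  rfl

theorem rn_odd_half (x : ℕ → Bool) (n : ℕ) :
    (rn σ p x (2 * n + 1)).2 = (rn σ p x (2 * n)).2 / 2 := by
  rw [rn_odd, tau, last_hist]
  split_ifs <;> rfl

theorem rules {P A : Set X} (hσ : WinningI P A σ) (x : ℕ → Bool) :
    ∀ k, Rule P (rn σ p x) k := by
  intro k
  induction k using Nat.strong_induction_on with
  | _ k ih =>
    obtain ⟨n, rfl | rfl⟩ := Nat.even_or_odd' k
    · exact (hσ _ (follows_rn σ p x)).1 n ih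
    · have h1 := (ih (2 * n) (by omega)).1
      have h2 : (2 * n + 1) % 2 = 1 := by omega
      refine ⟨?_, ?_⟩
      · rw [rn_odd_half]; linarith
      · rw [if_pos h2, rn_odd_half, Nat.add_sub_cancel]; linarith

theorem sub_rn {P A : Set X} (hσ : WinningI P A σ) (x : ℕ → Bool) (n : ℕ) :
    copySet P (rn σ p x (2 * (n + 1))) ⊆
      copySet P (rn σ p x (2 * n)) \ copySet P (rn σ p x (2 * n + 1)) := by
  have h := (rules σ p hσ x (2 * (n + 1))).2
  rw [if_neg (by omega)] at h
  exact h (by omega)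

end

section
variable {X : Type*} [NormedAddCommGroup X] [NormedSpace ℝ X]
    (P : Set X) (hPbd : Bornology.IsBounded P) (hPcl : IsClosed P)
    (hPconv : Convex ℝ P) (A : Set X) (σ : Strategy X) (hσ : WinningI P A σ) (p : X) (hp : p ∈ P)

theorem shrink_false (hPbd : Bornology.IsBounded P) (hPcl : IsClosed P)
    (hPconv : Convex ℝ P) (hσ : WinningI P A σ) (hp : p ∈ P) (x : ℕ → Bool) (n : ℕ)
    (hx : x n = false) :
    (rn σ p x (2 * (n + 1))).2 < (rn σ p x (2 * n)).2 / 2 ∧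
    fixPt (rn σ p x (2 * n)) (rn σ p x (2 * (n + 1))) ∈ P ∧
    copySet P (rn σ p x (2 * (n + 1))) ⊆
      copySet P (halfMove (rn σ p x (2 * n))
        (fixPt (rn σ p x (2 * n)) (rn σ p x (2 * (n + 1))))) := by
  refine key_copy P hPbd hPcl hPconv _ _ (rules σ p hσ x _).1 (rules σ p hσ x _).1 p hp ?_
  rw [← rn_odd_false σ p x n hx]
  exact sub_rn σ p hσ x n

theorem shrink (hPbd : Bornology.IsBounded P) (hPcl : IsClosed P)
    (hPconv : Convex ℝ P) (hσ : WinningI P A σ) (hp : p ∈ P) (x : ℕ → Bool) (n : ℕ) :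
    (rn σ p x (2 * (n + 1))).2 < (rn σ p x (2 * n)).2 / 2 := by
  cases hx : x n with
  | false => exact (shrink_false P A σ p hPbd hPcl hPconv hσ hp x n hx).1
  | true =>
    have hx' : ∀ i < n, Function.update x n false i = x i := fun i hi =>
      Function.update_of_ne hi.ne _ _
    have hn : Function.update x n false n = false := Function.update_self ..
    have h1 := shrink_false P A σ p hPbd hPcl hPconv hσ hp _ n hn
    have h2 := rn_odd_true σ p _ x n hx' hn hx
    have h3 := rn_congr σ p _ x n hx'
    refine (key_copy P hPbd hPcl hPconv _ _ (rules σ p hσ x _).1 (rules σ p hσ x _).1 _ h1.2.1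
      ?_).1
    have h4 := sub_rn σ p hσ x n
    rw [h2] at h4
    rw [← h3] at h4 ⊢
    exact h4

theorem disj (hPbd : Bornology.IsBounded P) (hPcl : IsClosed P)
    (hPconv : Convex ℝ P) (hσ : WinningI P A σ) (hp : p ∈ P) (x y : ℕ → Bool) (n : ℕ)
    (h : ∀ i < n, x i = y i) (hx : x n = false) (hy : y n = true) (a : X)
    (ha : a ∈ copySet P (rn σ p x (2 * (n + 1)))) (hb : a ∈ copySet P (rn σ p y (2 * (n + 1)))) :
    False := by
  have h1 := (sub_rn σ p hσ y n hb).2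
  rw [rn_odd_true σ p x y n h hx hy] at h1
  exact h1 ((shrink_false P A σ p hPbd hPcl hPconv hσ hp x n hx).2.2 ha)

theorem ratio_le (hPbd : Bornology.IsBounded P) (hPcl : IsClosed P)
    (hPconv : Convex ℝ P) (hσ : WinningI P A σ) (hp : p ∈ P) (x : ℕ → Bool) (n : ℕ) :
    (rn σ p x (2 * n)).2 ≤ (σ []).2 * (1 / 2) ^ n := by
  induction n with
  | zero => rw [rn_even]; simp [hist]
  | succ n ih =>
    have := shrink P A σ p hPbd hPcl hPconv hσ hp x n
    rw [pow_succ]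
    linarith

theorem dist_copy (hPbd : Bornology.IsBounded P) (c : X × ℝ) (hc : 0 < c.2) (a b : X)
    (ha : a ∈ copySet P c) (hb : b ∈ copySet P c) : dist a b ≤ c.2 * Metric.diam P := by
  obtain ⟨q, hq, rfl⟩ := (mem_copySet' P c _).1 ha
  obtain ⟨q', hq', rfl⟩ := (mem_copySet' P c _).1 hb
  rw [dist_add_left, dist_smul₀, Real.norm_of_nonneg hc.le]
  exact mul_le_mul_of_nonneg_left (Metric.dist_le_diam_of_mem hPbd hq hq') hc.le

end

/-- **Fact.** Let `X` be a real Banach space, let `P ⊆ X` be a bounded, closed, convex set,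
and let `A ⊆ X`.  If player I has a winning strategy in the no-β McMullen game `G_P(A)`,
then `A` contains a perfect set. -/
theorem winningI_containsPerfectSet {X : Type*} [NormedAddCommGroup X] [NormedSpace ℝ X]
    [CompleteSpace X] (P : Set X) (hPbd : Bornology.IsBounded P) (hPcl : IsClosed P)
    (hPconv : Convex ℝ P) (A : Set X) (σ : Strategy X) (hσ : WinningI P A σ) :
    ContainsPerfectSet A := by
  have hPne : P.Nonempty := by
    obtain ⟨a, ha, _⟩ := (hσ _ (follows_rn σ 0 (fun _ => false))).2
      (rules σ 0 hσ (fun _ => false))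
    obtain ⟨q, hq, _⟩ := (mem_copySet' P _ _).1 (Set.mem_iInter.1 ha 0)
    exact ⟨q, hq⟩
  obtain ⟨p, hp⟩ := hPne
  choose f hf using fun x => (hσ _ (follows_rn σ p x)).2 (rules σ p hσ x)
  have hfm : ∀ x n, f x ∈ copySet P (rn σ p x (2 * n)) := fun x n =>
    Set.mem_iInter.1 (hf x).1 n
  have hdist : ∀ x y n, (∀ i < n, x i = y i) →
      dist (f y) (f x) ≤ (σ []).2 * (1 / 2) ^ n * Metric.diam P := by
    intro x y n h
    have h1 := hfm y n
    rw [← rn_congr σ p x y n h] at h1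
    refine (dist_copy P hPbd _ (rules σ p hσ x (2 * n)).1 _ _ h1 (hfm x n)).trans ?_
    exact mul_le_mul_of_nonneg_right (ratio_le P A σ p hPbd hPcl hPconv hσ hp x n)
      Metric.diam_nonneg
  have hsmall : ∀ ε > 0, ∃ n : ℕ, (σ []).2 * (1 / 2) ^ n * Metric.diam P < ε := by
    intro ε hε
    have ht : Tendsto (fun n : ℕ => (σ []).2 * (1 / 2 : ℝ) ^ n * Metric.diam P) atTop
        (𝓝 ((σ []).2 * 0 * Metric.diam P)) :=
      ((tendsto_pow_atTop_nhds_zero_of_lt_one (by norm_num) (by norm_num)).const_mul _).mul_const _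
    rw [mul_zero, zero_mul] at ht
    exact (ht.eventually (gt_mem_nhds hε)).exists
  have hinj : Function.Injective f := by
    intro x y hxy
    by_contra hne
    have hex : ∃ n, x n ≠ y n := Function.ne_iff.1 hne
    classical
    have hn := Nat.find_spec hex
    have hlt : ∀ i < Nat.find hex, x i = y i := fun i hi => not_not.1 (Nat.find_min hex hi)
    generalize Nat.find hex = n at hn hlt
    cases hx : x n <;> cases hy : y n
    · simp [hx, hy] at hn
    · exact disj P A σ p hPbd hPcl hPconv hσ hp x y n hlt hx hy (f x) (hfm x _)
        (hxy ▸ hfm y _)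
    · exact disj P A σ p hPbd hPcl hPconv hσ hp y x n (fun i hi => (hlt i hi).symm) hy hx (f x)
        (hxy ▸ hfm y _) (hfm x _)
    · simp [hx, hy] at hn
  have hcont : Continuous f := by
    rw [continuous_iff_continuousAt]
    intro x
    rw [ContinuousAt, Metric.tendsto_nhds]
    intro ε hε
    obtain ⟨n, hn⟩ := hsmall ε hε
    have : ∀ᶠ y in 𝓝 x, ∀ i ∈ Finset.range n, x i = y i := by
      rw [Filter.eventually_all_finset]
      intro i _
      have h1 : Tendsto (fun y : ℕ → Bool => y i) (𝓝 x) (𝓝 (x i)) :=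
        (continuous_apply i).continuousAt
      rw [nhds_discrete Bool, tendsto_pure] at h1
      exact h1.mono fun y hy => hy.symm
    filter_upwards [this] with y hy
    exact (hdist x y n fun i hi => hy i (Finset.mem_range.2 hi)).trans_lt hn
  refine ⟨Set.range f, ?_, ⟨(isCompact_range hcont).isClosed, ?_⟩, Set.range_nonempty f⟩
  · rintro _ ⟨x, rfl⟩
    exact (hf x).2
  · rintro _ ⟨x, rfl⟩
    rw [accPt_iff_nhds]
    intro U hU
    obtain ⟨ε, hε, hU⟩ := Metric.mem_nhds_iff.1 hU
    obtain ⟨n, hn⟩ := hsmall ε hε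
    refine ⟨f (Function.update x n (!x n)), ⟨hU ?_, Set.mem_range_self _⟩, ?_⟩
    · exact (hdist x _ n fun i hi => (Function.update_of_ne hi.ne _ _).symm).trans_lt hn
    · intro h
      have := congrFun (hinj h) n
      simp at this
end
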